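/- arXiv:1701.09148 — 2 statements merged into one kernel-verified Lean document; each statement's English description precedes it below -/
import Mathlib

section
/- Let k = k(r) ≥ 2 and n = n(r) = k(r)·r be sequences with λ = k − 1 and k = o(n^{1−α}) for some fixed 0 < α < 1. Let μ_n = (1/2)·log²(√(n/λ)) and σ_n = (1/√3)·log^{3/2}(√(n/λ)). Then Y_n = (log B − μ_n)/σ_n on the uniform space of {0,k}-mappings on [n] converges in distribution to the standard normal as r → ∞; moreover there are constants C₁, C₂ > 0 such that for all real x and all sufficiently large r, |P_n^{{0,k}}(log B ≤ μ_n + x·σ_n) − φ(x)| ≤ C₁·|x|/log^{3/4}(√(n/λ)) + C₂·(log log n)²/log^{1/4}(n/λ). -/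
open Filter Finset Asymptotics MeasureTheory

noncomputable section

open scoped Classical

/-- `f` is a `{0,k}`-mapping: every point has either `0` or `k` preimages. -/
def IsZKMap {n : ℕ} (k : ℕ) (f : Fin n → Fin n) : Prop :=
  ∀ y : Fin n,
    (Finset.univ.filter fun x => f x = y).card = 0 ∨
    (Finset.univ.filter fun x => f x = y).card = k

/-- The finite set of `{0,k}`-mappings on `[n]`. -/
def zkMaps (n k : ℕ) : Finset (Fin n → Fin n) :=
  Finset.univ.filter fun f => IsZKMap k f

/-- The set of cyclic nodes of `f`. -/
def cyclicSet {n : ℕ} (f : Fin n → Fin n) : Finset (Fin n) :=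
  Finset.univ.filter fun x => ∃ m, 0 < m ∧ f^[m] x = x

/-- `Z f`: the number of cyclic nodes of `f`. -/
def Zmap {n : ℕ} (f : Fin n → Fin n) : ℕ := (cyclicSet f).card

/-- The cycles of `f`: the orbits of the cyclic nodes under `f`. -/
def cyclesOf {n : ℕ} (f : Fin n → Fin n) : Finset (Finset (Fin n)) :=
  (cyclicSet f).image fun x => (cyclicSet f).filter fun y => ∃ m, f^[m] x = y

/-- `T f`: the least common multiple of the cycle lengths of `f`. -/
def Tmap {n : ℕ} (f : Fin n → Fin n) : ℕ := (cyclesOf f).lcm Finset.card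

/-- `B f`: the product of the cycle lengths of `f`, counted with multiplicity. -/
def Bmap {n : ℕ} (f : Fin n → Fin n) : ℕ := ∏ c ∈ cyclesOf f, c.card

/-- `C f`: the number of cycles of `f`. -/
def Cmap {n : ℕ} (f : Fin n → Fin n) : ℕ := (cyclesOf f).card

/-- Uniform probability of the event `p` over `{0,k}`-mappings on `[n]`. -/
def zkProb (n k : ℕ) (p : (Fin n → Fin n) → Prop) : ℝ :=
  (((zkMaps n k).filter p).card : ℝ) / ((zkMaps n k).card : ℝ)

/-- Expectation of `X` under the uniform measure on `{0,k}`-mappings on `[n]`. -/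
def zkExp (n k : ℕ) (X : (Fin n → Fin n) → ℝ) : ℝ :=
  (∑ f ∈ zkMaps n k, X f) / ((zkMaps n k).card : ℝ)

/-- The standard normal cumulative distribution function. -/
def stdNormalCDF (x : ℝ) : ℝ :=
  (Real.sqrt (2 * Real.pi))⁻¹ * ∫ t in Set.Iic x, Real.exp (-t ^ 2 / 2)

/-- `M m`: the average order of a uniformly random permutation of `[m]`. -/
def Mperm (m : ℕ) : ℝ :=
  (∑ σ : Equiv.Perm (Fin m), (orderOf σ : ℝ)) / (m.factorial : ℝ)

/-- The logarithm of the product of the cycle lengths of a permutation. -/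
def logCycleProd {β : Type*} [Fintype β] [DecidableEq β] (σ : Equiv.Perm β) : ℝ :=
  Real.log (σ.cycleType.prod : ℕ)

/-- The expectation of `g (log B)` over uniform permutations of `m` points. -/
def permE (m : ℕ) (g : ℝ → ℝ) : ℝ :=
  (∑ σ : Equiv.Perm (Fin m), g (logCycleProd σ)) / (m.factorial : ℝ)

/-- Sums of class functions over the permutations supported on `{x | p x}`. -/
lemma sum_perm_supported_cycleType {β : Type*} [Fintype β] [DecidableEq β] (p : β → Prop)
    [DecidablePred p] (m : ℕ) (hm : (Finset.univ.filter p).card = m) (G : Multiset ℕ → ℝ) :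
    ∑ τ ∈ Finset.univ.filter (fun τ : Equiv.Perm β => ∀ a, ¬ p a → τ a = a),
      G τ.cycleType = ∑ σ : Equiv.Perm (Fin m), G σ.cycleType := by
  have hc : Fintype.card (Subtype p) = m := by rw [Fintype.card_subtype]; exact hm
  let e : Fin m ≃ Subtype p := (Fintype.equivFinOfCardEq hc).symm
  symm
  refine Finset.sum_bij (fun σ _ => σ.extendDomain e) ?_ ?_ ?_ ?_
  · intro σ _
    simp only [mem_filter, mem_univ, true_and]
    intro a ha
    exact Equiv.Perm.extendDomain_apply_not_subtype _ _ ha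
  · intro σ _ τ _ h
    exact Equiv.Perm.extendDomainHom_injective e h
  · intro τ hτ
    simp only [mem_filter, mem_univ, true_and] at hτ
    obtain ⟨ρ, hρ⟩ := (Equiv.Perm.subtypeEquivSubtypePerm p).surjective ⟨τ, hτ⟩
    refine ⟨e.symm.permCongr ρ, mem_univ _, ?_⟩
    have h2 : Equiv.Perm.ofSubtype ρ = τ := congrArg Subtype.val hρ
    rw [← h2]
    ext x
    by_cases hx : p x
    · rw [Equiv.Perm.extendDomain_apply_subtype _ _ hx, Equiv.Perm.ofSubtype_apply_of_mem _ hx]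
      simp [Equiv.permCongr_apply]
    · rw [Equiv.Perm.extendDomain_apply_not_subtype _ _ hx,
        Equiv.Perm.ofSubtype_apply_of_not_mem _ hx]
  · intro σ _
    rw [Equiv.Perm.cycleType_extendDomain]

lemma sum_perm_supported {β : Type*} [Fintype β] [DecidableEq β] (p : β → Prop)
    [DecidablePred p] (m : ℕ) (hm : (Finset.univ.filter p).card = m) (g : ℝ → ℝ) :
    ∑ τ ∈ Finset.univ.filter (fun τ : Equiv.Perm β => ∀ a, ¬ p a → τ a = a),
      g (logCycleProd τ) = (m.factorial : ℝ) * permE m g := by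
  have h0 : (m.factorial : ℝ) ≠ 0 := by positivity
  rw [permE, mul_div_cancel₀ _ h0]
  exact sum_perm_supported_cycleType p m hm (fun t => g (Real.log (t.prod : ℕ)))

lemma logCycleProd_eq_sum {β : Type*} [Fintype β] [DecidableEq β] (σ : Equiv.Perm β) :
    logCycleProd σ = ∑ c ∈ σ.cycleFactorsFinset, Real.log (c.support.card : ℝ) := by
  rw [logCycleProd, Equiv.Perm.cycleType_def]
  have : (Multiset.map (Finset.card ∘ Equiv.Perm.support) σ.cycleFactorsFinset.val).prod
      = ∏ c ∈ σ.cycleFactorsFinset, c.support.card := rfl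
  rw [this]
  push_cast
  rw [Real.log_prod]
  intro c hc
  have := (Equiv.Perm.mem_cycleFactorsFinset_iff.1 hc).1.two_le_card_support
  positivity

lemma logCycleProd_mul {β : Type*} [Fintype β] [DecidableEq β] {σ τ : Equiv.Perm β}
    (h : σ.Disjoint τ) : logCycleProd (σ * τ) = logCycleProd σ + logCycleProd τ := by
  rw [logCycleProd_eq_sum, logCycleProd_eq_sum, logCycleProd_eq_sum,
    h.cycleFactorsFinset_mul_eq_union, Finset.sum_union h.disjoint_cycleFactorsFinset]

lemma logCycleProd_isCycle {β : Type*} [Fintype β] [DecidableEq β] {σ : Equiv.Perm β}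
    (h : σ.IsCycle) : logCycleProd σ = Real.log (σ.support.card : ℝ) := by
  rw [logCycleProd_eq_sum, h.cycleFactorsFinset_eq_singleton, Finset.sum_singleton]

/-- Removing a fixed cycle `c` from the permutations that contain it. -/
lemma sum_perm_containing_cycle {m : ℕ} {c : Equiv.Perm (Fin m)} (hc : c.IsCycle)
    (F : ℝ → ℝ) :
    ∑ σ ∈ Finset.univ.filter (fun σ : Equiv.Perm (Fin m) => c ∈ σ.cycleFactorsFinset),
      F (logCycleProd σ) =
    ((m - c.support.card).factorial : ℝ) *
      permE (m - c.support.card) (fun s => F (s + Real.log (c.support.card : ℝ))) := by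
  rw [← sum_perm_supported (fun x : Fin m => x ∉ c.support)]
  · refine Finset.sum_bij' (fun σ _ => σ * c⁻¹) (fun τ _ => τ * c) ?_ ?_ ?_ ?_ ?_
    · intro σ hσ
      simp only [mem_filter, mem_univ, true_and, not_not] at hσ ⊢
      intro a ha
      have := Equiv.Perm.disjoint_mul_inv_of_mem_cycleFactorsFinset hσ a
      exact this.resolve_right (Equiv.Perm.mem_support.1 ha)
    · intro τ hτ
      simp only [mem_filter, mem_univ, true_and, not_not] at hτ ⊢
      rw [Equiv.Perm.mem_cycleFactorsFinset_iff]
      refine ⟨hc, fun a ha => ?_⟩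
      rw [Equiv.Perm.mul_apply, hτ _ (Equiv.Perm.apply_mem_support.2 ha)]
    · intro σ _; simp
    · intro σ _; simp
    · intro σ hσ
      simp only [mem_filter, mem_univ, true_and] at hσ
      have := Equiv.Perm.disjoint_mul_inv_of_mem_cycleFactorsFinset hσ
      rw [← logCycleProd_isCycle hc, ← logCycleProd_mul this]
      simp
  · trans (c.supportᶜ).card
    · congr 1
      ext x
      simp
    · rw [Finset.card_compl, Fintype.card_fin]

lemma card_cycles {m j : ℕ} (hj : 2 ≤ j) (hjm : j ≤ m) :
    ((Finset.univ.filter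
      (fun c : Equiv.Perm (Fin m) => c.IsCycle ∧ c.support.card = j)).card : ℝ) *
      ((m - j).factorial : ℝ) = (m.factorial : ℝ) / j := by
  have h1 : (Finset.univ.filter (fun c : Equiv.Perm (Fin m) => c.IsCycle ∧ c.support.card = j))
      = Finset.univ.filter (fun c : Equiv.Perm (Fin m) => c.cycleType = {j}) := by
    ext c
    simp only [mem_filter, mem_univ, true_and]
    constructor
    · rintro ⟨h, rfl⟩; exact h.cycleType
    · intro h
      have hc : c.IsCycle := by
        rw [← Equiv.Perm.card_cycleType_eq_one, h]; simp
      refine ⟨hc, ?_⟩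
      rw [hc.cycleType] at h
      simpa using h
  have h2 := Equiv.Perm.card_of_cycleType_singleton (α := Fin m) hj (by simpa using hjm)
  have h3 : (Finset.univ.filter (fun c : Equiv.Perm (Fin m) => c.cycleType = {j})).card =
      (j - 1).factorial * m.choose j := by
    convert h2 using 2
    simp
  rw [h1, h3]
  have h4 := Nat.choose_mul_factorial_mul_factorial hjm
  have h5 : j.factorial = j * (j - 1).factorial := (Nat.mul_factorial_pred (by omega)).symm
  have hj0 : (j : ℝ) ≠ 0 := by positivity
  rw [eq_div_iff hj0, ← h4, h5]
  push_cast
  ring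

/-- Summation over all cycles of all permutations. -/
lemma sum_perm_sum_cycles {m : ℕ} (F : ℕ → ℝ → ℝ) :
    ∑ σ : Equiv.Perm (Fin m), ∑ c ∈ σ.cycleFactorsFinset, F c.support.card (logCycleProd σ) =
    (m.factorial : ℝ) * ∑ j ∈ Finset.Icc 2 m,
      (1 / (j : ℝ)) * permE (m - j) (fun s => F j (s + Real.log (j : ℝ))) := by
  have h1 : ∑ σ : Equiv.Perm (Fin m), ∑ c ∈ σ.cycleFactorsFinset,
      F c.support.card (logCycleProd σ) =
      ∑ c ∈ Finset.univ.filter (fun c : Equiv.Perm (Fin m) => c.IsCycle),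
        ∑ σ ∈ Finset.univ.filter (fun σ : Equiv.Perm (Fin m) => c ∈ σ.cycleFactorsFinset),
          F c.support.card (logCycleProd σ) := by
    refine Finset.sum_comm' ?_
    intro σ c
    simp only [mem_filter, mem_univ, true_and]
    exact ⟨fun h => ⟨h, (Equiv.Perm.mem_cycleFactorsFinset_iff.1 h).1⟩, fun h => h.1⟩
  rw [h1, ← Finset.sum_fiberwise_of_maps_to (t := Finset.Icc 2 m)
    (g := fun c : Equiv.Perm (Fin m) => c.support.card), Finset.mul_sum]
  · refine Finset.sum_congr rfl fun j hj => ?_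
    rw [Finset.mem_Icc] at hj
    rw [Finset.filter_filter]
    rw [Finset.sum_congr rfl (g := fun _ => ((m - j).factorial : ℝ) *
      permE (m - j) (fun s => F j (s + Real.log (j : ℝ))))]
    · rw [Finset.sum_const, nsmul_eq_mul, ← mul_assoc, card_cycles hj.1 hj.2]
      ring
    · intro c hc
      simp only [mem_filter, mem_univ, true_and] at hc
      obtain ⟨hc1, rfl⟩ := hc
      exact sum_perm_containing_cycle hc1 _
  · intro c hc
    simp only [mem_filter, mem_univ, true_and] at hc
    rw [Finset.mem_Icc]
    refine ⟨hc.two_le_card_support, ?_⟩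
    simpa using Finset.card_le_univ c.support

lemma sum_perm_fixed_points {m : ℕ} (g : ℝ → ℝ) :
    ∑ σ : Equiv.Perm (Fin m),
      ∑ _a ∈ Finset.univ.filter (fun a => σ a = a), g (logCycleProd σ) =
    (m : ℝ) * (((m - 1).factorial : ℝ) * permE (m - 1) g) := by
  have h1 : ∑ σ : Equiv.Perm (Fin m),
      ∑ _a ∈ Finset.univ.filter (fun a => σ a = a), g (logCycleProd σ) =
      ∑ a : Fin m, ∑ σ ∈ Finset.univ.filter (fun σ : Equiv.Perm (Fin m) => σ a = a),
        g (logCycleProd σ) := by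
    refine Finset.sum_comm' ?_
    simp
  rw [h1, Finset.sum_congr rfl (g := fun _ => ((m - 1).factorial : ℝ) * permE (m - 1) g)]
  · simp
  · intro a _
    rw [← sum_perm_supported (fun x : Fin m => x ≠ a)]
    · refine Finset.sum_congr ?_ fun _ _ => rfl
      ext σ; simp
    · simp [Finset.filter_ne']

/-- The size-bias identity for `log B`. -/
lemma permE_mul_self (m : ℕ) (g : ℝ → ℝ) :
    permE m (fun s => s * g s) = ∑ j ∈ Finset.Icc 1 m,
      (Real.log j / j) * permE (m - j) (fun s => g (s + Real.log (j : ℝ))) := by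
  have h := sum_perm_sum_cycles (m := m) (fun j s => Real.log j * g s)
  have h0 : (m.factorial : ℝ) ≠ 0 := by positivity
  simp_rw [← Finset.sum_mul, ← logCycleProd_eq_sum] at h
  rw [permE, h, mul_div_cancel_left₀ _ h0]
  have h2 : ∀ j : ℕ, permE (m - j) (fun s => Real.log j * g (s + Real.log (j : ℝ))) =
      Real.log j * permE (m - j) (fun s => g (s + Real.log (j : ℝ))) := by
    intro j
    rw [permE, permE, ← Finset.mul_sum, mul_div_assoc]
  rw [← Finset.sum_subset (Finset.Icc_subset_Icc_left (one_le_two))]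
  · refine Finset.sum_congr rfl fun j _ => ?_
    rw [h2]; ring
  · intro j hj hj'
    rw [Finset.mem_Icc] at hj hj'
    have : j = 1 := by omega
    subst this
    simp

/-- The recursion for the law of `log B` given by the length of a typical cycle. -/
lemma permE_rec (m : ℕ) (g : ℝ → ℝ) :
    (m : ℝ) * permE m g = ∑ j ∈ Finset.Icc 1 m,
      permE (m - j) (fun s => g (s + Real.log (j : ℝ))) := by
  rcases Nat.eq_zero_or_pos m with rfl | hm
  · simp
  have h := sum_perm_sum_cycles (m := m) (fun j s => (j : ℝ) * g s)
  have h' := sum_perm_fixed_points (m := m) g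
  have h0 : (m.factorial : ℝ) ≠ 0 := by positivity
  have h2 : ∀ j ∈ Finset.Icc 2 m, (1 / (j : ℝ)) *
      permE (m - j) (fun s => (j : ℝ) * g (s + Real.log (j : ℝ))) =
      permE (m - j) (fun s => g (s + Real.log (j : ℝ))) := by
    intro j hj
    rw [Finset.mem_Icc] at hj
    have : (j : ℝ) ≠ 0 := by have := hj.1; positivity
    rw [permE, permE, ← Finset.mul_sum]
    field_simp
  rw [Finset.sum_congr rfl h2] at h
  have h3 : ∀ σ : Equiv.Perm (Fin m), ∑ c ∈ σ.cycleFactorsFinset,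
      (c.support.card : ℝ) * g (logCycleProd σ) +
      ∑ _a ∈ Finset.univ.filter (fun a => σ a = a), g (logCycleProd σ) =
      (m : ℝ) * g (logCycleProd σ) := by
    intro σ
    rw [← Finset.sum_mul, Finset.sum_const, nsmul_eq_mul, ← add_mul]
    congr 1
    have e1 := σ.sum_cycleType
    rw [Equiv.Perm.cycleType_def] at e1
    have e2 : (Multiset.map (Finset.card ∘ Equiv.Perm.support) σ.cycleFactorsFinset.val).sum
      = ∑ c ∈ σ.cycleFactorsFinset, c.support.card := rfl
    have e3 : (Finset.univ.filter (fun a => σ a = a)).card + σ.support.card = m := by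
      have := Finset.card_filter_add_card_filter_not (s := (Finset.univ : Finset (Fin m)))
        (fun a => σ a = a)
      rw [Finset.card_univ, Fintype.card_fin] at this
      exact this
    rw [e2] at e1
    rw [← Nat.cast_sum, e1, ← Nat.cast_add, add_comm, e3]
  have h4 : ∑ σ : Equiv.Perm (Fin m), (m : ℝ) * g (logCycleProd σ) =
      (m : ℝ) * ((m.factorial : ℝ) * permE m g) := by
    rw [permE, mul_div_cancel₀ _ h0, Finset.mul_sum]
  rw [← Finset.sum_congr rfl fun σ _ => h3 σ, Finset.sum_add_distrib, h, h'] at h4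
  have h5 : (m : ℝ) * ((m - 1).factorial : ℝ) = (m.factorial : ℝ) := by
    rw [← Nat.cast_mul, Nat.mul_factorial_pred hm.ne']
  rw [← mul_assoc, h5, ← mul_add] at h4
  have h6 : ∑ j ∈ Finset.Icc 1 m, permE (m - j) (fun s => g (s + Real.log (j : ℝ))) =
      ∑ j ∈ Finset.Icc 2 m, permE (m - j) (fun s => g (s + Real.log (j : ℝ))) +
        permE (m - 1) g := by
    rw [← Finset.add_sum_Ioc_eq_sum_Icc (by omega : 1 ≤ m)]
    have : Finset.Ioc 1 m = Finset.Icc 2 m := by ext; simp; omega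
    rw [this, add_comm]
    simp
  rw [h6]
  have : (m.factorial : ℝ) * (∑ j ∈ Finset.Icc 2 m,
      permE (m - j) (fun s => g (s + Real.log (j : ℝ))) + permE (m - 1) g) =
      (m.factorial : ℝ) * ((m : ℝ) * permE m g) := by rw [h4]; ring
  exact (mul_left_cancel₀ h0 this).symm

/-- A uniform permutation of `m` points has `1 / j` cycles of length `j` on average. -/
lemma sum_perm_card_cycles {m j : ℕ} (hj : 2 ≤ j) :
    ∑ σ : Equiv.Perm (Fin m),
      ((σ.cycleFactorsFinset.filter (fun c => c.support.card = j)).card : ℝ) =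
    if j ≤ m then (m.factorial : ℝ) / j else 0 := by
  have h := sum_perm_sum_cycles (m := m) (fun i _ => if i = j then 1 else 0)
  have h1 : ∀ σ : Equiv.Perm (Fin m),
      ((σ.cycleFactorsFinset.filter (fun c => c.support.card = j)).card : ℝ) =
      ∑ c ∈ σ.cycleFactorsFinset, if c.support.card = j then (1 : ℝ) else 0 := by
    intro σ; simp
  rw [Finset.sum_congr rfl fun σ _ => h1 σ, h]
  have h2 : ∀ i : ℕ, permE (m - i) (fun _ => if i = j then (1 : ℝ) else 0) =
      if i = j then 1 else 0 := by
    intro i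
    have : ((m - i).factorial : ℝ) ≠ 0 := by positivity
    rw [permE, Finset.sum_const, Finset.card_univ, Fintype.card_perm, Fintype.card_fin,
      nsmul_eq_mul, mul_div_cancel_left₀ _ this]
  simp_rw [h2]
  simp only [mul_ite, mul_one, mul_zero, Finset.sum_ite_eq', Finset.mem_Icc, hj, true_and]
  split_ifs <;> ring

lemma coe_cyclicSet {n : ℕ} (f : Fin n → Fin n) :
    (cyclicSet f : Set (Fin n)) = Function.periodicPts f := by
  ext x
  simp [cyclicSet, Function.periodicPts, Function.IsPeriodicPt, Function.IsFixedPt]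

lemma bijOn_cyclicSet {n : ℕ} (f : Fin n → Fin n) :
    Set.BijOn f (cyclicSet f) (cyclicSet f) := by
  rw [coe_cyclicSet]
  exact Function.bijOn_periodicPts f

lemma cyclicPerm_bijective {n : ℕ} (f : Fin n → Fin n) :
    Function.Bijective (fun x => if x ∈ cyclicSet f then f x else x) := by
  rw [← Finite.injective_iff_bijective]
  intro x y h
  have hb := bijOn_cyclicSet f
  simp only at h
  split_ifs at h with hx hy hy
  · exact hb.injOn hx hy h
  · exact absurd (h ▸ hb.mapsTo hx) hy
  · exact absurd (h ▸ hb.mapsTo hy) hx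
  · exact h

/-- The permutation induced by `f` on its cyclic nodes, extended by the identity. -/
def cyclicPerm {n : ℕ} (f : Fin n → Fin n) : Equiv.Perm (Fin n) :=
  Equiv.ofBijective _ (cyclicPerm_bijective f)

lemma cyclicPerm_of_mem {n : ℕ} {f : Fin n → Fin n} {x : Fin n} (hx : x ∈ cyclicSet f) :
    cyclicPerm f x = f x := by
  simp [cyclicPerm, hx]

lemma cyclicPerm_of_notMem {n : ℕ} {f : Fin n → Fin n} {x : Fin n} (hx : x ∉ cyclicSet f) :
    cyclicPerm f x = x := by
  simp [cyclicPerm, hx]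

lemma iterate_mem_cyclicSet {n : ℕ} {f : Fin n → Fin n} {x : Fin n} (hx : x ∈ cyclicSet f)
    (m : ℕ) : f^[m] x ∈ cyclicSet f :=
  (bijOn_cyclicSet f).mapsTo.iterate m hx

lemma cyclicPerm_pow {n : ℕ} {f : Fin n → Fin n} {x : Fin n} (hx : x ∈ cyclicSet f) (m : ℕ) :
    (cyclicPerm f ^ m) x = f^[m] x := by
  induction m with
  | zero => simp
  | succ m ih =>
    rw [pow_succ', Equiv.Perm.mul_apply, ih, cyclicPerm_of_mem (iterate_mem_cyclicSet hx m),
      Function.iterate_succ_apply']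

lemma mem_cyclicSet_of_mem_support {n : ℕ} {f : Fin n → Fin n} {x : Fin n}
    (hx : x ∈ (cyclicPerm f).support) : x ∈ cyclicSet f := by
  by_contra h
  exact Equiv.Perm.mem_support.1 hx (cyclicPerm_of_notMem h)

lemma exists_iterate_iff_sameCycle {n : ℕ} {f : Fin n → Fin n} {x : Fin n}
    (hx : x ∈ cyclicSet f) (y : Fin n) :
    (∃ m, f^[m] x = y) ↔ (cyclicPerm f).SameCycle x y := by
  constructor
  · rintro ⟨m, rfl⟩
    exact ⟨m, by rw [zpow_natCast, cyclicPerm_pow hx]⟩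
  · intro h
    obtain ⟨m, -, hm⟩ := h.exists_pow_eq' 
    exact ⟨m, by rw [← cyclicPerm_pow hx, hm]⟩

lemma Bmap_eq {n : ℕ} (f : Fin n → Fin n) : Bmap f = (cyclicPerm f).cycleType.prod := by
  rw [Equiv.Perm.cycleType_def]
  have : (Multiset.map (Finset.card ∘ Equiv.Perm.support) (cyclicPerm f).cycleFactorsFinset.val).prod
      = ∏ c ∈ (cyclicPerm f).cycleFactorsFinset, c.support.card := rfl
  have hne : Bmap f = ∏ c ∈ (cyclesOf f).filter (fun c => c.card ≠ 1), c.card := by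
    rw [Bmap, Finset.prod_filter_ne_one]
  have horb : ∀ x ∈ cyclicSet f, x ∈ (cyclicPerm f).support →
      (cyclicSet f).filter (fun y => ∃ m, f^[m] x = y) = ((cyclicPerm f).cycleOf x).support := by
    intro x hx hxs
    ext y
    rw [Finset.mem_filter, exists_iterate_iff_sameCycle hx, Equiv.Perm.mem_support_cycleOf_iff]
    constructor
    · exact fun h => ⟨h.2, hxs⟩
    · rintro ⟨h1, h2⟩
      exact ⟨mem_cyclicSet_of_mem_support (h1.mem_support_iff.1 h2), h1⟩
  have himg : (cyclesOf f).filter (fun c => c.card ≠ 1) =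
      (cyclicPerm f).cycleFactorsFinset.image Equiv.Perm.support := by
    ext s
    simp only [cyclesOf, Finset.mem_filter, Finset.mem_image]
    constructor
    · rintro ⟨⟨x, hx, rfl⟩, hs⟩
      by_cases hxs : x ∈ (cyclicPerm f).support
      · exact ⟨(cyclicPerm f).cycleOf x, Equiv.Perm.cycleOf_mem_cycleFactorsFinset_iff.2 hxs,
          (horb x hx hxs).symm⟩
      · exfalso
        apply hs
        rw [Finset.card_eq_one]
        refine ⟨x, ?_⟩
        ext y
        rw [Finset.mem_filter, exists_iterate_iff_sameCycle hx, Finset.mem_singleton]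
        constructor
        · rintro ⟨-, h⟩
          exact (h.eq_of_left (Equiv.Perm.notMem_support.1 hxs)).symm
        · rintro rfl
          exact ⟨hx, Equiv.Perm.SameCycle.refl _ _⟩
    · rintro ⟨c, hc, rfl⟩
      obtain ⟨x, hx⟩ := (Equiv.Perm.mem_cycleFactorsFinset_iff.1 hc).1.nonempty_support
      have hxs : x ∈ (cyclicPerm f).support := Equiv.Perm.mem_cycleFactorsFinset_support_le hc hx
      have hcx := Equiv.Perm.cycle_is_cycleOf hx hc
      refine ⟨⟨x, mem_cyclicSet_of_mem_support hxs, ?_⟩, ?_⟩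
      · rw [horb x (mem_cyclicSet_of_mem_support hxs) hxs, ← hcx]
      · have := (Equiv.Perm.mem_cycleFactorsFinset_iff.1 hc).1.two_le_card_support
        omega
  rw [this, hne, himg, Finset.prod_image]
  intro c hc d hd hcd
  obtain ⟨x, hx⟩ := (Equiv.Perm.mem_cycleFactorsFinset_iff.1 hc).1.nonempty_support
  have hcd' : c.support = d.support := hcd
  rw [Equiv.Perm.cycle_is_cycleOf hx hc, ← Equiv.Perm.cycle_is_cycleOf (hcd' ▸ hx) hd]

lemma log_Bmap {n : ℕ} (f : Fin n → Fin n) :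
    Real.log (Bmap f : ℝ) = logCycleProd (cyclicPerm f) := by
  rw [logCycleProd, Bmap_eq]

section Resampling

variable {n : ℕ} {f : Fin n → Fin n} {ρ : Equiv.Perm (Fin n)}

lemma cyclicSet_comp_perm (hρ : ∀ a, a ∉ cyclicSet f → ρ a = a) :
    cyclicSet (f ∘ ρ) = cyclicSet f := by
  have hmaps : ∀ a ∈ cyclicSet f, ρ a ∈ cyclicSet f := by
    intro a ha
    by_contra h
    have h1 := hρ _ h
    exact h (by rw [ρ.injective h1]; exact ha)
  ext x
  constructor
  · intro hx
    by_contra hxA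
    have hstay : ∀ y ∈ cyclicSet f, ∀ m, (f ∘ ρ)^[m] y ∈ cyclicSet f := by
      intro y hy m
      induction m with
      | zero => exact hy
      | succ m ih =>
        rw [Function.iterate_succ_apply']
        exact (bijOn_cyclicSet f).mapsTo (hmaps _ ih)
    obtain ⟨m, hm0, hm⟩ := (Finset.mem_filter.1 hx).2
    have hout : ∀ i ≤ m, (f ∘ ρ)^[i] x ∉ cyclicSet f := by
      intro i hi hmem
      have := hstay _ hmem (m - i)
      rw [← Function.iterate_add_apply, Nat.sub_add_cancel hi, hm] at this
      exact hxA this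
    have heq : ∀ i ≤ m, (f ∘ ρ)^[i] x = f^[i] x := by
      intro i
      induction i with
      | zero => intro _; rfl
      | succ i ih =>
        intro hi
        rw [Function.iterate_succ_apply', Function.iterate_succ_apply', ← ih (by omega),
          Function.comp_apply, hρ _ (hout i (by omega))]
    apply hxA
    rw [cyclicSet, Finset.mem_filter]
    exact ⟨Finset.mem_univ _, m, hm0, by rw [← heq m le_rfl, hm]⟩
  · intro hx
    have hmaps' : Set.MapsTo (f ∘ ρ) (cyclicSet f : Set (Fin n)) (cyclicSet f) :=
      fun a ha => (bijOn_cyclicSet f).mapsTo (hmaps a ha)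
    have hinj : Set.InjOn (f ∘ ρ) (cyclicSet f : Set (Fin n)) := fun a ha b hb hab =>
      ρ.injective ((bijOn_cyclicSet f).injOn (hmaps a ha) (hmaps b hb) hab)
    have hit : ∀ m, (f ∘ ρ)^[m] x ∈ cyclicSet f := fun m => hmaps'.iterate m hx
    obtain ⟨i, j, hij, he⟩ := Finite.exists_ne_map_eq_of_infinite (fun m => (f ∘ ρ)^[m] x)
    wlog hlt : i < j generalizing i j
    · exact this j i hij.symm he.symm (by omega)
    have hinj' : Set.InjOn ((f ∘ ρ)^[i]) (cyclicSet f : Set (Fin n)) := hinj.iterate hmaps' i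
    rw [cyclicSet, Finset.mem_filter]
    refine ⟨Finset.mem_univ _, j - i, by omega, ?_⟩
    refine (hinj' hx (hit (j - i)) ?_).symm
    rw [← Function.iterate_add_apply, Nat.add_sub_cancel' hlt.le]
    exact he

lemma cyclicPerm_comp_perm (hρ : ∀ a, a ∉ cyclicSet f → ρ a = a) :
    cyclicPerm (f ∘ ρ) = cyclicPerm f * ρ := by
  ext x
  have h := cyclicSet_comp_perm hρ
  rw [Equiv.Perm.mul_apply]
  by_cases hx : x ∈ cyclicSet f
  · have hρx : ρ x ∈ cyclicSet f := by
      by_contra h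
      exact h (by rw [ρ.injective (hρ _ h)]; exact hx)
    rw [cyclicPerm_of_mem (h ▸ hx), cyclicPerm_of_mem hρx, Function.comp_apply]
  · rw [cyclicPerm_of_notMem (h ▸ hx), hρ _ hx, cyclicPerm_of_notMem hx]

lemma isZKMap_comp_perm {k : ℕ} (ρ : Equiv.Perm (Fin n)) (hf : IsZKMap k f) :
    IsZKMap k (f ∘ ρ) := by
  intro y
  have : (Finset.univ.filter fun x => (f ∘ ρ) x = y).card =
      (Finset.univ.filter fun x => f x = y).card := by
    refine Finset.card_bij (fun x _ => ρ x) ?_ ?_ ?_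
    · intro x hx; simpa using hx
    · intro x _ x' _ h; exact ρ.injective h
    · intro x hx
      exact ⟨ρ.symm x, by simpa using hx, by simp⟩
  rw [this]
  exact hf y

lemma isZKMap_perm_comp {k : ℕ} (ρ : Equiv.Perm (Fin n)) (hf : IsZKMap k f) :
    IsZKMap k (ρ ∘ f) := by
  intro y
  have : (Finset.univ.filter fun x => (ρ ∘ f) x = y) =
      (Finset.univ.filter fun x => f x = ρ.symm y) := by
    ext x; simp [Equiv.eq_symm_apply]
  rw [this]
  exact hf _

end Resampling

/-- The `{0,k}`-mappings whose set of cyclic nodes is `A`. -/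
def zkMapsOn (n k : ℕ) (A : Finset (Fin n)) : Finset (Fin n → Fin n) :=
  (zkMaps n k).filter fun f => cyclicSet f = A

/-- Given the set of cyclic nodes, the induced permutation is uniform. -/
lemma sum_zkMapsOn {n k : ℕ} (A : Finset (Fin n)) (H : Equiv.Perm (Fin n) → ℝ) :
    ((Finset.univ.filter fun ρ : Equiv.Perm (Fin n) => ∀ a, a ∉ A → ρ a = a).card : ℝ) *
      ∑ f ∈ zkMapsOn n k A, H (cyclicPerm f) =
    ((zkMapsOn n k A).card : ℝ) *
      ∑ ρ ∈ Finset.univ.filter (fun ρ : Equiv.Perm (Fin n) => ∀ a, a ∉ A → ρ a = a), H ρ := by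
  set G := Finset.univ.filter fun ρ : Equiv.Perm (Fin n) => ∀ a, a ∉ A → ρ a = a with hG
  have hinv : ∀ ρ : Equiv.Perm (Fin n), (∀ a, a ∉ A → ρ a = a) →
      ∀ a, a ∉ A → ρ⁻¹ a = a := by
    intro ρ hρ a ha
    rw [Equiv.Perm.inv_eq_iff_eq, hρ a ha]
  have hmem : ∀ f ∈ zkMapsOn n k A, ∀ ρ ∈ G, f ∘ ρ ∈ zkMapsOn n k A := by
    intro f hf ρ hρ
    simp only [zkMapsOn, zkMaps, hG, Finset.mem_filter, Finset.mem_univ, true_and] at hf hρ ⊢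
    obtain ⟨h1, rfl⟩ := hf
    exact ⟨isZKMap_comp_perm ρ h1, cyclicSet_comp_perm hρ⟩
  have hGinv : ∀ ρ ∈ G, ρ⁻¹ ∈ G := by
    intro ρ hρ
    simp only [hG, Finset.mem_filter, Finset.mem_univ, true_and] at hρ ⊢
    exact hinv ρ hρ
  have h1 : ∀ ρ ∈ G, ∑ f ∈ zkMapsOn n k A, H (cyclicPerm f) =
      ∑ f ∈ zkMapsOn n k A, H (cyclicPerm f * ρ) := by
    intro ρ hρ
    refine Finset.sum_bij' (fun f _ => f ∘ ⇑(ρ⁻¹)) (fun f _ => f ∘ ρ)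
      (fun f hf => hmem f hf _ (hGinv ρ hρ)) (fun f hf => hmem f hf _ hρ) ?_ ?_ ?_
    · intro f _; ext x; simp
    · intro f _; ext x; simp
    · intro f hf
      have hf' := (Finset.mem_filter.1 hf).2
      rw [cyclicPerm_comp_perm (ρ := ρ⁻¹), inv_mul_cancel_right]
      rw [hf']
      exact (Finset.mem_filter.1 (hGinv ρ hρ)).2
  have h2 : ∀ f ∈ zkMapsOn n k A, ∑ ρ ∈ G, H (cyclicPerm f * ρ) = ∑ ρ ∈ G, H ρ := by
    intro f hf
    have hf' := (Finset.mem_filter.1 hf).2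
    have hfG : ∀ a, a ∉ A → cyclicPerm f a = a :=
      fun a ha => cyclicPerm_of_notMem (hf' ▸ ha)
    refine Finset.sum_bij' (fun ρ _ => cyclicPerm f * ρ) (fun ρ _ => (cyclicPerm f)⁻¹ * ρ)
      ?_ ?_ ?_ ?_ ?_
    · intro ρ hρ
      simp only [hG, Finset.mem_filter, Finset.mem_univ, true_and] at hρ ⊢
      intro a ha
      rw [Equiv.Perm.mul_apply, hρ a ha, hfG a ha]
    · intro ρ hρ
      simp only [hG, Finset.mem_filter, Finset.mem_univ, true_and] at hρ ⊢
      intro a ha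
      rw [Equiv.Perm.mul_apply, hρ a ha, hinv _ hfG a ha]
    · intro ρ _; simp
    · intro ρ _; simp
    · intro ρ _; rfl
  rw [← nsmul_eq_mul, ← Finset.sum_const, Finset.sum_congr rfl h1, Finset.sum_comm,
    Finset.sum_congr rfl h2, Finset.sum_const, nsmul_eq_mul]

lemma permE_const (m : ℕ) (c : ℝ) : permE m (fun _ => c) = c := by
  have h0 : (m.factorial : ℝ) ≠ 0 := by positivity
  rw [permE, Finset.sum_const, Finset.card_univ, Fintype.card_perm, Fintype.card_fin,
    nsmul_eq_mul, mul_div_cancel_left₀ _ h0]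

lemma card_perm_supported {n : ℕ} (A : Finset (Fin n)) :
    ((Finset.univ.filter fun ρ : Equiv.Perm (Fin n) => ∀ a, a ∉ A → ρ a = a).card : ℝ) =
      (A.card.factorial : ℝ) := by
  have h := sum_perm_supported (fun x : Fin n => x ∈ A) A.card (by simp) (fun _ => 1)
  rw [permE_const, mul_one, Finset.sum_const, nsmul_eq_mul, mul_one] at h
  norm_cast at h ⊢
  convert h

lemma sum_zkMapsOn_log {n k : ℕ} (A : Finset (Fin n)) (g : ℝ → ℝ) :
    ∑ f ∈ zkMapsOn n k A, g (Real.log (Bmap f : ℝ)) =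
      ((zkMapsOn n k A).card : ℝ) * permE A.card g := by
  have h := sum_zkMapsOn (k := k) A (fun ρ => g (logCycleProd ρ))
  have h2 : ∑ ρ ∈ Finset.univ.filter (fun ρ : Equiv.Perm (Fin n) => ∀ a, a ∉ A → ρ a = a),
      g (logCycleProd ρ) = (A.card.factorial : ℝ) * permE A.card g := by
    convert sum_perm_supported (fun x : Fin n => x ∈ A) A.card (by simp) g
  have h0 : (A.card.factorial : ℝ) ≠ 0 := by positivity
  rw [card_perm_supported, h2] at h
  simp_rw [log_Bmap]
  apply mul_left_cancel₀ h0
  rw [h]; ring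

lemma zkProb_eq {n k : ℕ} (p : (Fin n → Fin n) → Prop) [DecidablePred p] :
    zkProb n k p = (((zkMaps n k).filter p).card : ℝ) / ((zkMaps n k).card : ℝ) := by
  rw [zkProb]
  congr!

/-- The law of `log B` is the mixture of its laws over uniform permutations. -/
lemma zkProb_log_Bmap {n k : ℕ} (t : ℝ) :
    zkProb n k (fun f => Real.log (Bmap f : ℝ) ≤ t) =
      ∑ m ∈ Finset.range (n + 1), zkProb n k (fun f => Zmap f = m) *
        permE m (fun s => if s ≤ t then 1 else 0) := by
  have h1 : (((zkMaps n k).filter (fun f => Real.log (Bmap f : ℝ) ≤ t)).card : ℝ) =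
      ∑ A : Finset (Fin n), ((zkMapsOn n k A).card : ℝ) *
        permE A.card (fun s => if s ≤ t then 1 else 0) := by
    rw [Finset.card_filter]
    push_cast
    rw [← Finset.sum_fiberwise (zkMaps n k) cyclicSet]
    exact Finset.sum_congr rfl fun A _ => sum_zkMapsOn_log A (fun s => if s ≤ t then 1 else 0)
  have h2 : ∀ m : ℕ, (((zkMaps n k).filter (fun f => Zmap f = m)).card : ℝ) =
      ∑ A ∈ Finset.univ.filter (fun A : Finset (Fin n) => A.card = m),
        ((zkMapsOn n k A).card : ℝ) := by
    intro m
    rw [← Nat.cast_sum, Finset.card_eq_sum_card_fiberwise (f := cyclicSet)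
      (t := Finset.univ.filter (fun A : Finset (Fin n) => A.card = m))]
    · congr 1
      refine Finset.sum_congr rfl fun A hA => ?_
      rw [zkMapsOn, Finset.filter_filter]
      congr 1
      refine Finset.filter_congr fun f _ => ?_
      simp only [Finset.mem_filter, Finset.mem_univ, true_and] at hA
      constructor
      · exact fun h => h.2
      · intro h
        exact ⟨by rw [Zmap, h, hA], h⟩
    · intro f hf
      simpa [Zmap] using (Finset.mem_filter.1 hf).2
  simp only [zkProb_eq]
  rw [h1, ← Finset.sum_fiberwise_of_maps_to (t := Finset.range (n + 1)) (g := Finset.card),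
    Finset.sum_div]
  · refine Finset.sum_congr rfl fun m _ => ?_
    rw [h2, div_mul_eq_mul_div, Finset.sum_mul]
    congr 1
    refine Finset.sum_congr rfl fun A hA => ?_
    rw [(Finset.mem_filter.1 hA).2]
  · intro A _
    rw [Finset.mem_range]
    have := Finset.card_le_univ A
    rw [Fintype.card_fin] at this
    omega

lemma card_image_zkMap {n k r : ℕ} (hk : 0 < k) (hn : n = k * r) {f : Fin n → Fin n}
    (hf : IsZKMap k f) : (Finset.univ.image f).card = r := by
  have h := Finset.card_eq_sum_card_image f Finset.univ
  rw [Finset.card_univ, Fintype.card_fin, Finset.sum_congr rfl (g := fun _ => k)] at h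
  · rw [Finset.sum_const, smul_eq_mul] at h
    exact Nat.eq_of_mul_eq_mul_right hk (h.symm.trans (hn.trans (mul_comm k r)))
  · intro y hy
    obtain ⟨x, -, rfl⟩ := Finset.mem_image.1 hy
    refine (hf (f x)).resolve_left ?_
    exact Finset.card_ne_zero_of_mem (a := x) (by simp)

lemma card_embedding_lift {n k j : ℕ} {f : Fin n → Fin n}
    (hf : IsZKMap k f) (y : Fin j ↪ Fin n) :
    (Finset.univ.filter fun x : Fin j ↪ Fin n => ∀ i, f (x i) = y i).card =
      if ∀ i, y i ∈ Finset.univ.image f then k ^ j else 0 := by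
  have h1 : (Finset.univ.filter fun x : Fin j ↪ Fin n => ∀ i, f (x i) = y i).card =
      (Fintype.piFinset fun i => Finset.univ.filter fun a => f a = y i).card := by
    refine Finset.card_bij (fun x _ => x) ?_ ?_ ?_
    · intro x hx
      simpa [Fintype.mem_piFinset] using hx
    · intro x _ x' _ h
      exact DFunLike.coe_injective h
    · intro x hx
      simp only [Fintype.mem_piFinset, Finset.mem_filter, Finset.mem_univ, true_and] at hx
      refine ⟨⟨x, fun a b hab => y.injective ?_⟩, ?_, rfl⟩
      · rw [← hx a, ← hx b, hab]
      · simp only [Finset.mem_filter, Finset.mem_univ, true_and]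
        exact hx
  rw [h1, Fintype.card_piFinset]
  split_ifs with h
  · rw [Finset.prod_congr rfl (g := fun _ => k)]
    · simp
    · intro i _
      refine (hf (y i)).resolve_left ?_
      obtain ⟨a, -, ha⟩ := Finset.mem_image.1 (h i)
      exact Finset.card_ne_zero_of_mem (a := a) (by simpa using ha)
  · push Not at h
    obtain ⟨i, hi⟩ := h
    refine Finset.prod_eq_zero (Finset.mem_univ i) ?_
    rw [Finset.card_eq_zero, Finset.filter_eq_empty_iff]
    intro a _ ha
    exact hi (ha ▸ Finset.mem_image_of_mem f (Finset.mem_univ a))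

lemma card_embedding_into {n j : ℕ} (s : Finset (Fin n)) :
    (Finset.univ.filter fun y : Fin j ↪ Fin n => ∀ i, y i ∈ s).card = s.card.descFactorial j := by
  have h : Fintype.card (Fin j ↪ s) = s.card.descFactorial j := by
    rw [Fintype.card_embedding_eq]; simp
  rw [← h, ← Finset.card_univ]
  symm
  refine Finset.card_bij (fun y _ => y.trans (Function.Embedding.subtype _)) ?_ ?_ ?_
  · intro y _
    simp
  · intro y _ y' _ h
    ext i
    have := DFunLike.congr_fun h i
    simpa using congrArg Fin.val this
  · intro y hy
    simp only [Finset.mem_filter, Finset.mem_univ, true_and] at hy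
    refine ⟨⟨fun i => ⟨y i, hy i⟩, fun a b hab => y.injective (by simpa using hab)⟩,
      Finset.mem_univ _, ?_⟩
    ext i
    rfl

/-- The `{0,k}`-mappings sending `x i` to `y i`. -/
def zkMapsVia {j : ℕ} (n k : ℕ) (x y : Fin j ↪ Fin n) : Finset (Fin n → Fin n) :=
  (zkMaps n k).filter fun f => ∀ i, f (x i) = y i

lemma card_zkMapsVia_le {n k j : ℕ} (x y x' y' : Fin j ↪ Fin n) :
    (zkMapsVia n k x y).card ≤ (zkMapsVia n k x' y').card := by
  obtain ⟨π, hπ⟩ := Equiv.Perm.exists_extending_pair x' x x'.injective x.injective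
  obtain ⟨ρ, hρ⟩ := Equiv.Perm.exists_extending_pair y y' y.injective y'.injective
  refine Finset.card_le_card_of_injOn (fun f => ρ ∘ f ∘ π) ?_ ?_
  · intro f hf
    simp only [zkMapsVia, zkMaps, Finset.coe_filter, Finset.mem_filter, Finset.mem_univ, true_and,
      Set.mem_ofPred_eq] at hf ⊢
    refine ⟨isZKMap_perm_comp ρ (isZKMap_comp_perm π hf.1), fun i => ?_⟩
    have h1 : π (x' i) = x i := hπ i
    have h2 : ρ (y i) = y' i := hρ i
    simp only [Function.comp_apply]
    rw [h1, hf.2, h2]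
  · intro f _ g _ h
    funext a
    have := congrFun h (π.symm a)
    simpa using this

/-- The number of `{0,k}`-mappings with prescribed distinct values at `j` points. -/
lemma card_zkMapsVia {n k r j : ℕ} (hk : 0 < k) (hn : n = k * r) (x y : Fin j ↪ Fin n) :
    n.descFactorial j * (n.descFactorial j * (zkMapsVia n k x y).card) =
      (zkMaps n k).card * (r.descFactorial j * k ^ j) := by
  have hE : (Finset.univ : Finset (Fin j ↪ Fin n)).card = n.descFactorial j := by
    rw [Finset.card_univ, Fintype.card_embedding_eq]; simp
  have h1 : ∑ y' : Fin j ↪ Fin n, ∑ x' : Fin j ↪ Fin n, (zkMapsVia n k x' y').card =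
      n.descFactorial j * (n.descFactorial j * (zkMapsVia n k x y).card) := by
    rw [Finset.sum_congr rfl
      (g := fun _ => n.descFactorial j * (zkMapsVia n k x y).card)]
    · rw [Finset.sum_const, hE, smul_eq_mul]
    · intro y' _
      rw [Finset.sum_congr rfl (g := fun _ => (zkMapsVia n k x y).card)]
      · rw [Finset.sum_const, hE, smul_eq_mul]
      · intro x' _
        exact le_antisymm (card_zkMapsVia_le _ _ _ _) (card_zkMapsVia_le _ _ _ _)
  have h2 : ∀ y' : Fin j ↪ Fin n, ∑ x' : Fin j ↪ Fin n, (zkMapsVia n k x' y').card =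
      ∑ f ∈ zkMaps n k, (Finset.univ.filter fun x : Fin j ↪ Fin n => ∀ i, f (x i) = y' i).card := by
    intro y'
    simp_rw [zkMapsVia, Finset.card_filter]
    exact Finset.sum_comm
  rw [← h1, Finset.sum_congr rfl fun y' _ => h2 y', Finset.sum_comm, ← smul_eq_mul (zkMaps n k).card,
    ← Finset.sum_const]
  refine Finset.sum_congr rfl fun f hf => ?_
  have hf' : IsZKMap k f := (Finset.mem_filter.1 hf).2
  rw [Finset.sum_congr rfl fun y' _ => card_embedding_lift hf' y', ← Finset.sum_filter,
    Finset.sum_const, smul_eq_mul, card_embedding_into, card_image_zkMap hk hn hf']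

lemma mem_cycleFactorsFinset_cyclicPerm {n : ℕ} (f : Fin n → Fin n) (c : Equiv.Perm (Fin n)) :
    c ∈ (cyclicPerm f).cycleFactorsFinset ↔ c.IsCycle ∧ ∀ a ∈ c.support, f a = c a := by
  rw [Equiv.Perm.mem_cycleFactorsFinset_iff]
  refine and_congr_right fun hc => ⟨fun h a ha => ?_, fun h a ha => ?_⟩
  · have h1 := h a ha
    rw [h1, cyclicPerm_of_mem]
    apply mem_cyclicSet_of_mem_support
    rw [Equiv.Perm.mem_support, ← h1]
    exact Equiv.Perm.mem_support.1 ha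
  · have hit : ∀ m : ℕ, f^[m] a = (c ^ m) a := by
      intro m
      induction m with
      | zero => rfl
      | succ m ih =>
        rw [Function.iterate_succ_apply', ih, pow_succ', Equiv.Perm.mul_apply,
          h _ (Equiv.Perm.pow_apply_mem_support.2 ha)]
    have hmem : a ∈ cyclicSet f := by
      rw [cyclicSet, Finset.mem_filter]
      refine ⟨Finset.mem_univ _, orderOf c, orderOf_pos c, ?_⟩
      rw [hit, pow_orderOf_eq_one, Equiv.Perm.one_apply]
    rw [cyclicPerm_of_mem hmem, h a ha]

lemma sum_card_cycles_eq_card_ge {n k j : ℕ} (hj : 2 ≤ j) :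
    ∑ f ∈ zkMaps n k,
      (((cyclicPerm f).cycleFactorsFinset.filter (fun c => c.support.card = j)).card : ℝ) =
    (((zkMaps n k).filter fun f => j ≤ Zmap f).card : ℝ) / j := by
  have hcount : ∀ (m : ℕ) (ρ : Equiv.Perm (Fin m)),
      (ρ.cycleFactorsFinset.filter (fun c => c.support.card = j)).card = ρ.cycleType.count j := by
    intro m ρ
    rw [Equiv.Perm.cycleType_def, Multiset.count_map, Finset.card_def, Finset.filter_val]
    congr 1
    refine Multiset.filter_congr fun c _ => ?_
    exact eq_comm
  have h1 : ∀ A : Finset (Fin n), ∑ f ∈ zkMapsOn n k A,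
      (((cyclicPerm f).cycleFactorsFinset.filter (fun c => c.support.card = j)).card : ℝ) =
      ((zkMapsOn n k A).card : ℝ) * (if j ≤ A.card then 1 / (j : ℝ) else 0) := by
    intro A
    have h := sum_zkMapsOn (k := k) A (fun ρ => (ρ.cycleType.count j : ℝ))
    have h2 : ∑ ρ ∈ Finset.univ.filter (fun ρ : Equiv.Perm (Fin n) => ∀ a, a ∉ A → ρ a = a),
        (ρ.cycleType.count j : ℝ) = if j ≤ A.card then (A.card.factorial : ℝ) / j else 0 := by
      have h3 := sum_perm_card_cycles (m := A.card) hj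
      simp_rw [hcount] at h3
      rw [← h3]
      convert sum_perm_supported_cycleType (fun x : Fin n => x ∈ A) A.card (by simp)
        (fun t => (t.count j : ℝ))
    have h0 : (A.card.factorial : ℝ) ≠ 0 := by positivity
    rw [card_perm_supported, h2] at h
    simp_rw [hcount]
    apply mul_left_cancel₀ h0
    rw [h]
    split_ifs <;> ring
  rw [← Finset.sum_fiberwise (zkMaps n k) cyclicSet]
  refine (Finset.sum_congr rfl fun A _ => h1 A).trans ?_
  rw [Finset.card_filter]
  push_cast
  rw [← Finset.sum_fiberwise (zkMaps n k) cyclicSet, Finset.sum_div]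
  refine Finset.sum_congr rfl fun A _ => ?_
  rw [Finset.sum_congr rfl (g := fun _ => if j ≤ A.card then (1 : ℝ) else 0)]
  · rw [Finset.sum_const, nsmul_eq_mul, zkMapsOn]
    split_ifs <;> ring
  · intro f hf
    rw [Zmap, (Finset.mem_filter.1 hf).2]

/-- The exact law of the number of cyclic nodes. -/
lemma card_zkMaps_le_Zmap {n k r j : ℕ} (hk : 0 < k) (hn : n = k * r) (hj : 2 ≤ j) (hjn : j ≤ n) :
    (n.descFactorial j : ℝ) * (((zkMaps n k).filter fun f => j ≤ Zmap f).card : ℝ) =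
      ((zkMaps n k).card : ℝ) * ((r.descFactorial j : ℝ) * (k : ℝ) ^ j) := by
  have hj0 : (j : ℝ) ≠ 0 := by positivity
  have hd0 : (n.descFactorial j : ℝ) ≠ 0 := by
    have := Nat.descFactorial_pos.2 hjn
    positivity
  have hf0 : ((n - j).factorial : ℝ) ≠ 0 := by positivity
  have h1 := sum_card_cycles_eq_card_ge (n := n) (k := k) hj
  have h2 : ∑ f ∈ zkMaps n k,
      (((cyclicPerm f).cycleFactorsFinset.filter (fun c => c.support.card = j)).card : ℝ) =
      ∑ c ∈ Finset.univ.filter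
        (fun c : Equiv.Perm (Fin n) => c.IsCycle ∧ c.support.card = j),
        (((zkMaps n k).filter fun f => ∀ a ∈ c.support, f a = c a).card : ℝ) := by
    simp_rw [Finset.card_eq_sum_ones]
    push_cast
    refine Finset.sum_comm' ?_
    intro f c
    simp only [Finset.mem_filter, Finset.mem_univ, true_and, mem_cycleFactorsFinset_cyclicPerm]
    tauto
  have h3 : ∀ c ∈ Finset.univ.filter
        (fun c : Equiv.Perm (Fin n) => c.IsCycle ∧ c.support.card = j),
        (((zkMaps n k).filter fun f => ∀ a ∈ c.support, f a = c a).card : ℝ) =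
        ((zkMaps n k).card : ℝ) * ((r.descFactorial j : ℝ) * (k : ℝ) ^ j) /
          (n.descFactorial j : ℝ) ^ 2 := by
    intro c hc
    simp only [Finset.mem_filter, Finset.mem_univ, true_and] at hc
    let e := c.support.equivFinOfCardEq hc.2
    let x : Fin j ↪ Fin n := e.symm.toEmbedding.trans (Function.Embedding.subtype _)
    have h4 := card_zkMapsVia hk hn x (x.trans c.toEmbedding)
    have h5 : (zkMaps n k).filter (fun f => ∀ a ∈ c.support, f a = c a) =
        zkMapsVia n k x (x.trans c.toEmbedding) := by
      refine Finset.filter_congr fun f _ => ⟨fun h i => ?_, fun h a ha => ?_⟩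
      · exact h _ (e.symm i).2
      · have := h (e ⟨a, ha⟩)
        simpa [x] using this
    rw [h5, eq_div_iff (pow_ne_zero 2 hd0)]
    have h6 : ((n.descFactorial j * (n.descFactorial j *
      (zkMapsVia n k x (x.trans c.toEmbedding)).card) : ℕ) : ℝ) =
      (((zkMaps n k).card * (r.descFactorial j * k ^ j) : ℕ) : ℝ) := by rw [h4]
    push_cast at h6
    linarith
  rw [h2, Finset.sum_congr rfl h3, Finset.sum_const, nsmul_eq_mul] at h1
  have h7 := card_cycles hj hjn
  have h8 : ((n - j).factorial : ℝ) * (n.descFactorial j : ℝ) = (n.factorial : ℝ) := by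
    rw [← Nat.cast_mul, Nat.factorial_mul_descFactorial hjn]
  rw [← h8] at h7
  have h9 : ((Finset.univ.filter
      (fun c : Equiv.Perm (Fin n) => c.IsCycle ∧ c.support.card = j)).card : ℝ) =
      (n.descFactorial j : ℝ) / j := by
    apply mul_right_cancel₀ hf0
    rw [h7]; ring
  rw [h9] at h1
  field_simp at h1
  linarith

lemma zkMaps_card_pos {n k r : ℕ} (hk : 0 < k) (hn : n = k * r) : 0 < (zkMaps n k).card := by
  subst hn
  rw [Finset.card_pos]
  refine ⟨fun i => ⟨i / k, lt_of_le_of_lt (Nat.div_le_self _ _) i.2⟩, ?_⟩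
  simp only [zkMaps, Finset.mem_filter, Finset.mem_univ, true_and]
  intro y
  by_cases hy : (y : ℕ) < r
  · right
    refine Eq.trans (Eq.symm ?_) (Finset.card_fin k)
    have hlt : ∀ b : Fin k, (y : ℕ) * k + b < k * r := by
      intro b
      calc (y : ℕ) * k + b < y * k + k := by omega
        _ = k * (y + 1) := by ring
        _ ≤ k * r := Nat.mul_le_mul_left k hy
    refine Finset.card_bij (fun b _ => ⟨(y : ℕ) * k + b, hlt b⟩) ?_ ?_ ?_
    · intro b _
      simp only [Finset.mem_filter, Finset.mem_univ, true_and]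
      ext
      simp only
      rw [mul_comm, Nat.mul_add_div hk, Nat.div_eq_of_lt b.2, add_zero]
    · intro b _ b' _ h
      ext
      simpa using h
    · intro x hx
      simp only [Finset.mem_filter, Finset.mem_univ, true_and] at hx
      refine ⟨⟨x % k, Nat.mod_lt _ hk⟩, Finset.mem_univ _, ?_⟩
      ext
      simp only [← hx]
      exact Nat.div_add_mod' _ _
  · left
    rw [Finset.card_eq_zero, Finset.filter_eq_empty_iff]
    intro x _ h
    apply hy
    rw [← h]
    exact Nat.div_lt_of_lt_mul x.2

lemma zkProb_le_Zmap {n k r j : ℕ} (hk : 0 < k) (hn : n = k * r) (hj : 2 ≤ j) (hjn : j ≤ n) :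
    zkProb n k (fun f => j ≤ Zmap f) =
      ∏ i ∈ Finset.range j, ((n : ℝ) - i * k) / ((n : ℝ) - i) := by
  have hN : ((zkMaps n k).card : ℝ) ≠ 0 := by
    have := zkMaps_card_pos hk hn
    positivity
  have hd0 : (n.descFactorial j : ℝ) ≠ 0 := by
    have := Nat.descFactorial_pos.2 hjn
    positivity
  have h1 : (n.descFactorial j : ℝ) = ∏ i ∈ Finset.range j, ((n : ℝ) - i) := by
    rw [Nat.descFactorial_eq_prod_range]
    push_cast
    refine Finset.prod_congr rfl fun i hi => ?_
    rw [Finset.mem_range] at hi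
    rw [Nat.cast_sub (by omega)]
  have h2 : (r.descFactorial j : ℝ) * (k : ℝ) ^ j = ∏ i ∈ Finset.range j, ((n : ℝ) - i * k) := by
    have h3 : ∏ i ∈ Finset.range j, ((n : ℝ) - i * k) =
        (∏ i ∈ Finset.range j, ((r : ℝ) - i)) * (k : ℝ) ^ j := by
      rw [← Finset.card_range j, ← Finset.prod_const, Finset.card_range,
        ← Finset.prod_mul_distrib]
      refine Finset.prod_congr rfl fun i _ => ?_
      rw [hn]; push_cast; ring
    rw [h3]
    congr 1
    rcases le_or_gt j r with hjr | hjr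
    · rw [Nat.descFactorial_eq_prod_range]
      push_cast
      refine Finset.prod_congr rfl fun i hi => ?_
      rw [Finset.mem_range] at hi
      rw [Nat.cast_sub (by omega)]
    · rw [Nat.descFactorial_eq_zero_iff_lt.2 hjr, Nat.cast_zero]
      exact (Finset.prod_eq_zero (Finset.mem_range.2 hjr) (sub_self _)).symm
  rw [Finset.prod_div_distrib, ← h1, ← h2, zkProb_eq, div_eq_div_iff hN hd0]
  have := card_zkMaps_le_Zmap hk hn hj hjn
  linarith

lemma permE_mono {m : ℕ} {g h : ℝ → ℝ} (hgh : ∀ s, g s ≤ h s) : permE m g ≤ permE m h := by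
  unfold permE
  gcongr
  exact hgh _

lemma permE_add (m : ℕ) (g h : ℝ → ℝ) :
    permE m (fun s => g s + h s) = permE m g + permE m h := by
  simp only [permE, Finset.sum_add_distrib, add_div]

lemma permE_sub (m : ℕ) (g h : ℝ → ℝ) :
    permE m (fun s => g s - h s) = permE m g - permE m h := by
  simp only [permE, Finset.sum_sub_distrib, sub_div]

lemma permE_const_mul (m : ℕ) (c : ℝ) (g : ℝ → ℝ) :
    permE m (fun s => c * g s) = c * permE m g := by
  simp only [permE, ← Finset.mul_sum, mul_div_assoc]

lemma abs_permE_le (m : ℕ) (g : ℝ → ℝ) : |permE m g| ≤ permE m (fun s => |g s|) := by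
  unfold permE
  rw [abs_div, Nat.abs_cast]
  gcongr
  exact Finset.abs_sum_le_sum_abs _ _

/-- The sum `∑ log^p j / j` over `1 ≤ j ≤ m`. -/
def logSum (p m : ℕ) : ℝ := ∑ j ∈ Finset.Icc 1 m, Real.log j ^ p / j

lemma logSum_succ (p m : ℕ) :
    logSum p (m + 1) = logSum p m + Real.log ((m + 1 : ℕ) : ℝ) ^ p / ((m + 1 : ℕ) : ℝ) := by
  unfold logSum
  rw [Finset.sum_Icc_succ_top (by omega)]

lemma logSum_mono (p : ℕ) : Monotone (logSum p) := by
  refine monotone_nat_of_le_succ fun m => ?_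
  rw [logSum_succ]
  have : 0 ≤ Real.log ((m + 1 : ℕ) : ℝ) := Real.log_natCast_nonneg _
  have := pow_nonneg this p
  have : 0 ≤ Real.log ((m + 1 : ℕ) : ℝ) ^ p / ((m + 1 : ℕ) : ℝ) := by positivity
  linarith

lemma logSum_nonneg (p m : ℕ) : 0 ≤ logSum p m := by
  have := logSum_mono p (Nat.zero_le m)
  simpa [logSum] using this

lemma permE_id (m : ℕ) : permE m (fun s => s) = logSum 1 m := by
  have h := permE_mul_self m (fun _ => 1)
  simp only [mul_one, permE_const] at h
  rw [h]
  simp [logSum]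

lemma permE_rec_range (m : ℕ) (g : ℝ → ℝ) : (m : ℝ) * permE m g =
    ∑ i ∈ Finset.range m, permE i (fun s => g (s + Real.log ((m - i : ℕ) : ℝ))) := by
  rw [permE_rec]
  refine Finset.sum_nbij' (fun j => m - j) (fun i => m - i) ?_ ?_ ?_ ?_ ?_
  · intro j hj; rw [Finset.mem_Icc] at hj; rw [Finset.mem_range]; omega
  · intro j hj; rw [Finset.mem_range] at hj; rw [Finset.mem_Icc]; omega
  · intro j hj; rw [Finset.mem_Icc] at hj; omega
  · intro j hj; rw [Finset.mem_range] at hj; omega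
  · intro j hj
    rw [Finset.mem_Icc] at hj
    have : m - (m - j) = j := by omega
    rw [this]

lemma sum_log_sub_log (m : ℕ) :
    ∑ i ∈ Finset.range m,
      (Real.log ((m + 1 - i : ℕ) : ℝ) - Real.log ((m - i : ℕ) : ℝ)) =
      Real.log ((m + 1 : ℕ) : ℝ) := by
  have h := Finset.sum_range_sub' (fun i => Real.log ((m + 1 - i : ℕ) : ℝ)) m
  simp only [Nat.sub_zero] at h
  have h1 : m + 1 - m = 1 := by omega
  rw [h1, Nat.cast_one, Real.log_one, sub_zero] at h
  rw [← h]
  refine Finset.sum_congr rfl fun i _ => ?_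
  have : m + 1 - (i + 1) = m - i := by omega
  rw [this]

lemma abs_permE_succ_sub_le {m : ℕ} {g : ℝ → ℝ} {K : ℝ}
    (hg : ∀ x y, |g x - g y| ≤ K * |x - y|) :
    |permE (m + 1) g - permE m g| ≤
      K * (Real.log ((m + 1 : ℕ) : ℝ) / ((m + 1 : ℕ) : ℝ)) := by
  have h1 := permE_rec_range (m + 1) g
  have h2 := permE_rec_range m g
  rw [Finset.sum_range_succ] at h1
  have h3 : m + 1 - m = 1 := by omega
  rw [h3] at h1
  simp only [Nat.cast_one, Real.log_one, add_zero] at h1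
  have h4 : ((m + 1 : ℕ) : ℝ) * (permE (m + 1) g - permE m g) =
      ∑ i ∈ Finset.range m, permE i (fun s => g (s + Real.log ((m + 1 - i : ℕ) : ℝ)) -
        g (s + Real.log ((m - i : ℕ) : ℝ))) := by
    rw [mul_sub, h1]
    simp_rw [permE_sub]
    rw [Finset.sum_sub_distrib, ← h2]
    push_cast
    ring
  have hpos : (0 : ℝ) < ((m + 1 : ℕ) : ℝ) := by positivity
  rw [mul_div_assoc', le_div_iff₀ hpos, mul_comm, ← abs_of_pos hpos, ← abs_mul, h4,
    abs_of_pos hpos, ← sum_log_sub_log, Finset.mul_sum]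
  refine (Finset.abs_sum_le_sum_abs _ _).trans (Finset.sum_le_sum fun i hi => ?_)
  rw [Finset.mem_range] at hi
  refine (abs_permE_le _ _).trans ?_
  rw [← permE_const i (K * _)]
  refine permE_mono fun s => (hg _ _).trans ?_
  have hpos' : (0 : ℝ) < ((m - i : ℕ) : ℝ) := by
    have : 0 < m - i := by omega
    positivity
  have hle : Real.log ((m - i : ℕ) : ℝ) ≤ Real.log ((m + 1 - i : ℕ) : ℝ) := by
    apply Real.log_le_log hpos'
    have : m - i ≤ m + 1 - i := by omega
    exact_mod_cast this
  rw [add_sub_add_left_eq_sub, abs_of_nonneg (by linarith)]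

lemma abs_permE_sub_le {m l : ℕ} (hlm : l ≤ m) {g : ℝ → ℝ} {K : ℝ}
    (hg : ∀ x y, |g x - g y| ≤ K * |x - y|) :
    |permE m g - permE l g| ≤ K * (Real.log m * ∑ i ∈ Finset.Ioc l m, 1 / (i : ℝ)) := by
  have hK : 0 ≤ K := by
    have := (abs_nonneg _).trans (hg 1 0)
    simpa using this
  have key : |permE m g - permE l g| ≤ K * ∑ i ∈ Finset.Ioc l m, Real.log i / (i : ℝ) := by
    induction m, hlm using Nat.le_induction with
    | base => simp
    | succ m hm ih =>
      rw [Finset.sum_Ioc_succ_top (by omega), mul_add]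
      have h1 := abs_permE_succ_sub_le (m := m) hg
      have h2 := abs_sub_le (permE (m + 1) g) (permE m g) (permE l g)
      linarith
  refine key.trans (mul_le_mul_of_nonneg_left ?_ hK)
  rw [Finset.mul_sum]
  refine Finset.sum_le_sum fun i hi => ?_
  rw [Finset.mem_Ioc] at hi
  have hi0 : (0 : ℝ) < i := by
    have : 0 < i := by omega
    positivity
  rw [mul_one_div]
  gcongr
  exact hi.2

lemma permE_var_le (m : ℕ) :
    permE m (fun s => (s - logSum 1 m) ^ 2) ≤ logSum 2 m := by
  have h1 : permE m (fun s => (s - logSum 1 m) ^ 2) =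
      permE m (fun s => s * (s - logSum 1 m)) := by
    have : (fun s : ℝ => (s - logSum 1 m) ^ 2) =
        fun s => s * (s - logSum 1 m) - logSum 1 m * (s - logSum 1 m) := by
      funext s; ring
    rw [this, permE_sub, permE_const_mul, permE_sub m (fun s => s), permE_id, permE_const]
    ring
  rw [h1, permE_mul_self m (fun s => s - logSum 1 m)]
  unfold logSum
  refine Finset.sum_le_sum fun j hj => ?_
  rw [Finset.mem_Icc] at hj
  have h0 : 0 ≤ Real.log (j : ℝ) := Real.log_natCast_nonneg j
  have h2 : permE (m - j) (fun s => s + Real.log (j : ℝ) - logSum 1 m) ≤ Real.log j := by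
    have : (fun s : ℝ => s + Real.log (j : ℝ) - logSum 1 m) =
        fun s => s + (Real.log (j : ℝ) - logSum 1 m) := by funext s; ring
    rw [this, permE_add, permE_id, permE_const]
    have := logSum_mono 1 (Nat.sub_le m j)
    linarith
  calc Real.log (j : ℝ) / j * permE (m - j) (fun s => s + Real.log (j : ℝ) - logSum 1 m)
      ≤ Real.log (j : ℝ) / j * Real.log j := by gcongr
    _ = Real.log (j : ℝ) ^ 2 / j := by ring

lemma sum_inv_mul_sum_Ioc_inv_le (m : ℕ) :
    ∑ j ∈ Finset.Icc 1 m, 1 / (j : ℝ) * ∑ i ∈ Finset.Ioc (m - j) m, 1 / (i : ℝ) ≤ 2 := by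
  rcases Nat.eq_zero_or_pos m with rfl | hm
  · simp
  have hm0 : (0 : ℝ) < m := by positivity
  have h1 : ∀ j ∈ Finset.Icc 1 m, 1 / (j : ℝ) * ∑ i ∈ Finset.Ioc (m - j) m, 1 / (i : ℝ) ≤
      1 / m + ∑ i ∈ Finset.Ioc (m - j) m, 1 / (i : ℝ) / m := by
    intro j hj
    rw [Finset.mem_Icc] at hj
    have hj0 : (0 : ℝ) < j := by
      have : 0 < j := by omega
      positivity
    have hc : ∑ i ∈ Finset.Ioc (m - j) m, (1 / (j : ℝ) / m) = 1 / m := by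
      rw [Finset.sum_const, Nat.card_Ioc, nsmul_eq_mul, show m - (m - j) = j by omega]
      field_simp
    rw [← hc, ← Finset.sum_add_distrib, Finset.mul_sum]
    refine Finset.sum_le_sum fun i hi => ?_
    rw [Finset.mem_Ioc] at hi
    have hi0 : (0 : ℝ) < i := by
      have : 0 < i := by omega
      positivity
    have hij : (m : ℝ) ≤ i + j := by
      have : m ≤ i + j := by omega
      exact_mod_cast this
    have : 1 / (j : ℝ) / m + 1 / (i : ℝ) / m = (i + j) / (i * j * m) := by field_simp
    rw [this, le_div_iff₀ (by positivity)]
    have : 1 / (j : ℝ) * (1 / i) * (i * j * m) = m := by field_simp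
    linarith
  refine (Finset.sum_le_sum h1).trans ?_
  rw [Finset.sum_add_distrib]
  have h2 : ∑ j ∈ Finset.Icc 1 m, (1 / (m : ℝ)) = 1 := by
    rw [Finset.sum_const, Nat.card_Icc, nsmul_eq_mul, Nat.add_sub_cancel]
    field_simp
  have h3 : ∑ j ∈ Finset.Icc 1 m, ∑ i ∈ Finset.Ioc (m - j) m, 1 / (i : ℝ) / m =
      ∑ i ∈ Finset.Icc 1 m, ∑ j ∈ Finset.Ioc (m - i) m, 1 / (i : ℝ) / m := by
    refine Finset.sum_comm' ?_
    intro j i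
    simp only [Finset.mem_Icc, Finset.mem_Ioc]
    omega
  have h4 : ∑ i ∈ Finset.Icc 1 m, ∑ j ∈ Finset.Ioc (m - i) m, 1 / (i : ℝ) / m = 1 := by
    refine (Finset.sum_congr rfl fun i hi => ?_).trans h2
    rw [Finset.mem_Icc] at hi
    have hi0 : (0 : ℝ) < i := by
      have : 0 < i := by omega
      positivity
    rw [Finset.sum_const, Nat.card_Ioc, nsmul_eq_mul, show m - (m - i) = i by omega]
    field_simp
  rw [h2, h3, h4]
  norm_num

lemma one_div_succ_le_log_sub {j : ℕ} (hj : 1 ≤ j) :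
    1 / ((j : ℝ) + 1) ≤ Real.log (j + 1) - Real.log j := by
  have hj0 : (0 : ℝ) < j := by positivity
  rw [← Real.log_div (by positivity) hj0.ne']
  have := Real.one_sub_inv_le_log_of_pos (x := ((j : ℝ) + 1) / j) (by positivity)
  refine le_trans (le_of_eq ?_) this
  field_simp
  ring

lemma log_sub_le_one_div {j : ℕ} (hj : 1 ≤ j) :
    Real.log (j + 1) - Real.log j ≤ 1 / (j : ℝ) := by
  have hj0 : (0 : ℝ) < j := by positivity
  rw [← Real.log_div (by positivity) hj0.ne']
  have := Real.log_le_sub_one_of_pos (x := ((j : ℝ) + 1) / j) (by positivity)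
  refine this.trans (le_of_eq ?_)
  field_simp
  ring

lemma logSum_one_le (m : ℕ) : logSum 1 m ≤ Real.log m ^ 2 / 2 + Real.log m := by
  rcases Nat.eq_zero_or_pos m with rfl | hm
  · simp [logSum]
  induction m, hm using Nat.le_induction with
  | base => simp [logSum]
  | succ j hj ih =>
    rw [logSum_succ]
    push_cast
    have h1 := one_div_succ_le_log_sub hj
    have h0 : 0 ≤ Real.log (j : ℝ) := Real.log_natCast_nonneg j
    have hj1 : (1 : ℝ) ≤ j := by exact_mod_cast hj
    set a := Real.log (j : ℝ)
    set b := Real.log ((j : ℝ) + 1)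
    set u := 1 / ((j : ℝ) + 1) with hu
    have hu0 : 0 ≤ u := by positivity
    have hu1 : u ≤ 1 := by rw [hu, div_le_one (by positivity)]; linarith
    have e : b ^ 1 / ((j : ℝ) + 1) = b * u := by rw [hu]; ring
    rw [e]
    nlinarith [mul_nonneg h0 (sub_nonneg.2 h1), mul_nonneg (sub_nonneg.2 hu1)
      (show 0 ≤ b - a by linarith), sq_nonneg (b - a)]

lemma le_logSum_one (m : ℕ) : Real.log m ^ 2 / 2 - Real.log m ≤ logSum 1 m := by
  rcases Nat.eq_zero_or_pos m with rfl | hm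
  · simp [logSum]
  have key : ∀ i : ℕ, 1 ≤ i → i ≤ m →
      Real.log i ^ 2 / 2 ≤ logSum 1 i + Real.log m * (1 - 1 / (i : ℝ)) := by
    intro i hi
    induction i, hi using Nat.le_induction with
    | base => simp [logSum]
    | succ j hj ih =>
      intro hjm
      have ih := ih (by omega)
      rw [logSum_succ]
      have hjm' : Real.log ((j + 1 : ℕ) : ℝ) ≤ Real.log m :=
        Real.log_le_log (by positivity) (by exact_mod_cast hjm)
      push_cast at hjm' ⊢
      have h1 := one_div_succ_le_log_sub hj
      have h2 := log_sub_le_one_div hj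
      have h0 : 0 ≤ Real.log (j : ℝ) := Real.log_natCast_nonneg j
      have hj1 : (1 : ℝ) ≤ j := by exact_mod_cast hj
      have h3 : 1 / ((j : ℝ) + 1) ≤ 1 / (j : ℝ) := by gcongr; linarith
      set a := Real.log (j : ℝ)
      set b := Real.log ((j : ℝ) + 1)
      have e : b ^ 1 / ((j : ℝ) + 1) = b * (1 / ((j : ℝ) + 1)) := by ring
      rw [e]
      set u := 1 / ((j : ℝ) + 1) with hu
      set v := 1 / (j : ℝ)
      have hu0 : 0 ≤ u := by positivity
      nlinarith [mul_nonneg (sub_nonneg.2 h3) (sub_nonneg.2 hjm'),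
        mul_nonneg (show 0 ≤ b by linarith) (sub_nonneg.2 h2), sq_nonneg (b - a)]
  have := key m hm le_rfl
  have h0 : 0 ≤ Real.log (m : ℝ) := Real.log_natCast_nonneg m
  have : Real.log m * (1 - 1 / (m : ℝ)) ≤ Real.log m := by
    have : 0 ≤ Real.log m * (1 / (m : ℝ)) := by positivity
    linarith
  linarith

lemma logSum_two_le (m : ℕ) : logSum 2 m ≤ Real.log m ^ 3 / 3 + Real.log m ^ 2 := by
  rcases Nat.eq_zero_or_pos m with rfl | hm
  · simp [logSum]
  induction m, hm using Nat.le_induction with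
  | base => simp [logSum]
  | succ j hj ih =>
    rw [logSum_succ]
    push_cast
    have h1 := one_div_succ_le_log_sub hj
    have h0 : 0 ≤ Real.log (j : ℝ) := Real.log_natCast_nonneg j
    have hj1 : (1 : ℝ) ≤ j := by exact_mod_cast hj
    set a := Real.log (j : ℝ)
    set b := Real.log ((j : ℝ) + 1)
    have e : b ^ 2 / ((j : ℝ) + 1) = b ^ 2 * (1 / ((j : ℝ) + 1)) := by ring
    rw [e]
    set u := 1 / ((j : ℝ) + 1) with hu
    have hu0 : 0 ≤ u := by positivity
    have hu1 : u ≤ 1 := by rw [hu, div_le_one (by positivity)]; linarith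
    have hab : 0 ≤ b - a := by linarith
    have h2 : a ^ 2 * u ≤ a ^ 2 * (b - a) := by gcongr
    have h3 : a ^ 2 * (b - a) ≤ (b ^ 3 - a ^ 3) / 3 := by
      have : (b ^ 3 - a ^ 3) / 3 - a ^ 2 * (b - a) = (b - a) ^ 2 * (b + 2 * a) / 3 := by ring
      have : 0 ≤ (b - a) ^ 2 * (b + 2 * a) / 3 := by
        have : 0 ≤ b := by linarith
        positivity
      linarith
    have h4 : (b ^ 2 - a ^ 2) * u ≤ (b ^ 2 - a ^ 2) * 1 := by
      have : 0 ≤ b ^ 2 - a ^ 2 := by nlinarith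
      gcongr
    linarith

lemma le_logSum_two (m : ℕ) : Real.log m ^ 3 / 3 - Real.log m ^ 2 ≤ logSum 2 m := by
  rcases Nat.eq_zero_or_pos m with rfl | hm
  · simp [logSum]
  have key : ∀ i : ℕ, 1 ≤ i → i ≤ m →
      Real.log i ^ 3 / 3 ≤ logSum 2 i + Real.log m ^ 2 * (1 - 1 / (i : ℝ)) := by
    intro i hi
    induction i, hi using Nat.le_induction with
    | base => simp [logSum]
    | succ j hj ih =>
      intro hjm
      have ih := ih (by omega)
      rw [logSum_succ]
      have hjm' : Real.log ((j + 1 : ℕ) : ℝ) ≤ Real.log m :=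
        Real.log_le_log (by positivity) (by exact_mod_cast hjm)
      push_cast at hjm' ⊢
      have h1 := one_div_succ_le_log_sub hj
      have h2 := log_sub_le_one_div hj
      have h0 : 0 ≤ Real.log (j : ℝ) := Real.log_natCast_nonneg j
      have hj1 : (1 : ℝ) ≤ j := by exact_mod_cast hj
      have h3 : 1 / ((j : ℝ) + 1) ≤ 1 / (j : ℝ) := by gcongr; linarith
      set a := Real.log (j : ℝ)
      set b := Real.log ((j : ℝ) + 1)
      have e : b ^ 2 / ((j : ℝ) + 1) = b ^ 2 * (1 / ((j : ℝ) + 1)) := by ring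
      rw [e]
      set u := 1 / ((j : ℝ) + 1) with hu
      set v := 1 / (j : ℝ)
      have hu0 : 0 ≤ u := by positivity
      have hb0 : 0 ≤ b := by linarith
      have hab : 0 ≤ b - a := by linarith
      have h4 : (b ^ 3 - a ^ 3) / 3 ≤ b ^ 2 * (b - a) := by
        have : b ^ 2 * (b - a) - (b ^ 3 - a ^ 3) / 3 = (b - a) ^ 2 * (2 * b + a) / 3 := by ring
        have : 0 ≤ (b - a) ^ 2 * (2 * b + a) / 3 := by positivity
        linarith
      have h5 : b ^ 2 * (b - a) ≤ b ^ 2 * v := by gcongr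
      have h6 : b ^ 2 * (v - u) ≤ Real.log m ^ 2 * (v - u) := by
        have : 0 ≤ v - u := by linarith
        gcongr
      linarith
  have := key m hm le_rfl
  have : Real.log m ^ 2 * (1 - 1 / (m : ℝ)) ≤ Real.log m ^ 2 := by
    have : 0 ≤ Real.log m ^ 2 * (1 / (m : ℝ)) := by positivity
    linarith
  linarith

lemma logSum_three_le (m : ℕ) : logSum 3 m ≤ Real.log m * logSum 2 m := by
  unfold logSum
  rw [Finset.mul_sum]
  refine Finset.sum_le_sum fun j hj => ?_
  rw [Finset.mem_Icc] at hj
  have hj0 : (0 : ℝ) < j := by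
    have : 0 < j := by omega
    positivity
  have h1 : Real.log (j : ℝ) ≤ Real.log m := Real.log_le_log hj0 (by exact_mod_cast hj.2)
  calc Real.log (j : ℝ) ^ 3 / j = Real.log (j : ℝ) * (Real.log (j : ℝ) ^ 2 / j) := by ring
    _ ≤ Real.log m * (Real.log (j : ℝ) ^ 2 / j) := by gcongr

lemma integrable_exp_neg_sq_div_two : Integrable (fun t : ℝ => Real.exp (-t ^ 2 / 2)) := by
  have h := integrable_exp_neg_mul_sq (b := 1 / 2) (by norm_num)
  refine h.congr (Filter.Eventually.of_forall fun t => ?_)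
  simp only
  congr 1; ring

lemma integral_exp_neg_sq_div_two :
    ∫ t : ℝ, Real.exp (-t ^ 2 / 2) = Real.sqrt (2 * Real.pi) := by
  have h := integral_gaussian (1 / 2)
  rw [show Real.pi / (1 / 2) = 2 * Real.pi by ring] at h
  rw [← h]
  congr 1; funext t; congr 1; ring

lemma hasDerivAt_exp_neg_sq_div_two (t : ℝ) :
    HasDerivAt (fun t : ℝ => Real.exp (-t ^ 2 / 2)) (-t * Real.exp (-t ^ 2 / 2)) t := by
  have h : HasDerivAt (fun t : ℝ => -t ^ 2 / 2) (-t) t := by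
    refine (((hasDerivAt_pow 2 t).neg).div_const 2).congr_deriv ?_
    norm_num
    ring
  exact h.exp.congr_deriv (by ring)

lemma integrable_mul_exp_neg_sq_div_two :
    Integrable (fun t : ℝ => -t * Real.exp (-t ^ 2 / 2)) := by
  have h := (integrable_mul_exp_neg_mul_sq (b := 1 / 2) (by norm_num)).neg
  refine h.congr (Filter.Eventually.of_forall fun t => ?_)
  simp only [Pi.neg_apply]
  rw [show -(1 / 2) * t ^ 2 = -t ^ 2 / 2 by ring]
  ring

lemma tendsto_exp_neg_sq_div_two_atTop :
    Tendsto (fun t : ℝ => Real.exp (-t ^ 2 / 2)) atTop (nhds 0) := by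
  refine Real.tendsto_exp_atBot.comp ?_
  have h : Tendsto (fun t : ℝ => t ^ 2 / 2) atTop atTop :=
    (tendsto_pow_atTop (by norm_num)).atTop_div_const (by norm_num)
  refine (tendsto_neg_atTop_atBot.comp h).congr fun t => ?_
  simp only [Function.comp_apply]; ring

lemma mul_integral_Ioi_exp_le {x : ℝ} :
    x * ∫ t in Set.Ioi x, Real.exp (-t ^ 2 / 2) ≤ Real.exp (-x ^ 2 / 2) := by
  have h := integral_Ioi_of_hasDerivAt_of_tendsto' (a := x)
    (fun t _ => hasDerivAt_exp_neg_sq_div_two t)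
    integrable_mul_exp_neg_sq_div_two.integrableOn tendsto_exp_neg_sq_div_two_atTop
  have h2 : x * ∫ t in Set.Ioi x, Real.exp (-t ^ 2 / 2) ≤
      -∫ t in Set.Ioi x, -t * Real.exp (-t ^ 2 / 2) := by
    rw [← integral_const_mul, ← integral_neg]
    refine setIntegral_mono_on (integrable_exp_neg_sq_div_two.integrableOn.const_mul x)
      integrable_mul_exp_neg_sq_div_two.integrableOn.neg measurableSet_Ioi fun t ht => ?_
    rw [neg_mul, neg_neg]
    exact mul_le_mul_of_nonneg_right (le_of_lt ht) (Real.exp_pos _).le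
  rw [h] at h2
  linarith

lemma neg_mul_integral_Iic_exp_le {x : ℝ} :
    -x * ∫ t in Set.Iic x, Real.exp (-t ^ 2 / 2) ≤ Real.exp (-x ^ 2 / 2) := by
  have h := mul_integral_Ioi_exp_le (x := -x)
  rw [← integral_comp_neg_Iic] at h
  simpa using h

/-- The solution of Stein's equation for a Lipschitz test function with values in `[0, 1]`. -/
lemma exists_stein_solution {h : ℝ → ℝ} {K : ℝ} (hK : 0 ≤ K) (h0 : ∀ x, 0 ≤ h x)
    (h1 : ∀ x, h x ≤ 1)
    (hL : ∀ x y, |h x - h y| ≤ K * |x - y|) {c : ℝ}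
    (hc : c = (Real.sqrt (2 * Real.pi))⁻¹ * ∫ t, h t * Real.exp (-t ^ 2 / 2)) :
    ∃ f f' : ℝ → ℝ, (∀ x, HasDerivAt f (f' x) x) ∧ (∀ x, f' x = x * f x + h x - c) ∧
      (∀ x, |f x| ≤ 5) ∧ (∀ x, |x * f x| ≤ 1) := by
  have hcont : Continuous h := by
    have : LipschitzWith ⟨K, hK⟩ h := LipschitzWith.of_dist_le_mul fun x y => hL x y
    exact this.continuous
  have hgint := integrable_exp_neg_sq_div_two
  have hsq : 0 < Real.sqrt (2 * Real.pi) := Real.sqrt_pos.2 (by positivity)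
  have hhint : Integrable (fun t => h t * Real.exp (-t ^ 2 / 2)) := by
    refine hgint.mono' (by fun_prop) (Filter.Eventually.of_forall fun t => ?_)
    rw [Real.norm_eq_abs, abs_mul, abs_of_nonneg (h0 t), abs_of_pos (Real.exp_pos _)]
    have := h1 t
    have := Real.exp_pos (-t ^ 2 / 2)
    nlinarith
  have hc' : ∫ t, h t * Real.exp (-t ^ 2 / 2) = c * Real.sqrt (2 * Real.pi) := by
    rw [hc]; field_simp
  have hc0 : 0 ≤ c := by
    rw [hc]
    have : 0 ≤ ∫ t, h t * Real.exp (-t ^ 2 / 2) :=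
      integral_nonneg fun t => mul_nonneg (h0 t) (Real.exp_pos _).le
    positivity
  have hc1 : c ≤ 1 := by
    have : ∫ t, h t * Real.exp (-t ^ 2 / 2) ≤ ∫ t : ℝ, Real.exp (-t ^ 2 / 2) := by
      refine integral_mono hhint hgint fun t => ?_
      have := h1 t
      have := Real.exp_pos (-t ^ 2 / 2)
      simp only
      nlinarith
    rw [hc', integral_exp_neg_sq_div_two] at this
    nlinarith
  have hbd : ∀ t, |(h t - c) * Real.exp (-t ^ 2 / 2)| ≤ Real.exp (-t ^ 2 / 2) := by
    intro t
    rw [abs_mul, abs_of_pos (Real.exp_pos _)]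
    have : |h t - c| ≤ 1 := by
      rw [abs_le]; constructor <;> linarith [h0 t, h1 t]
    have := Real.exp_pos (-t ^ 2 / 2)
    nlinarith
  set q : ℝ → ℝ := fun t => (h t - c) * Real.exp (-t ^ 2 / 2) with hq
  have hqcont : Continuous q := by fun_prop
  have hqint : Integrable q := hgint.mono' hqcont.aestronglyMeasurable
    (Filter.Eventually.of_forall hbd)
  have hqtot : ∫ t, q t = 0 := by
    have : q = fun t => h t * Real.exp (-t ^ 2 / 2) - c * Real.exp (-t ^ 2 / 2) := by
      funext t; simp only [hq]; ring
    rw [this, integral_sub hhint (hgint.const_mul c), hc', integral_const_mul,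
      integral_exp_neg_sq_div_two, sub_self]
  set G : ℝ → ℝ := fun x => ∫ t in Set.Iic x, q t with hG
  have hGderiv : ∀ x, HasDerivAt G (q x) x := by
    intro x
    have e : G = fun y => (∫ t in (0 : ℝ)..y, q t) + G 0 := by
      funext y
      have := intervalIntegral.integral_Iic_sub_Iic (a := 0) (b := y) hqint.integrableOn
        hqint.integrableOn
      simp only [hG]
      linarith
    rw [e]
    exact (intervalIntegral.integral_hasDerivAt_right (hqcont.intervalIntegrable _ _)
      (hqcont.stronglyMeasurableAtFilter _ _) hqcont.continuousAt).add_const _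
  have hGle1 : ∀ x, |G x| ≤ ∫ t in Set.Iic x, Real.exp (-t ^ 2 / 2) := by
    intro x
    refine (norm_integral_le_of_norm_le (f := q) hgint.integrableOn
      (Filter.Eventually.of_forall hbd))
  have hGle2 : ∀ x, |G x| ≤ ∫ t in Set.Ioi x, Real.exp (-t ^ 2 / 2) := by
    intro x
    have : G x = -∫ t in Set.Ioi x, q t := by
      have := intervalIntegral.integral_Iic_add_Ioi (b := x) hqint.integrableOn hqint.integrableOn
      rw [hqtot] at this
      simp only [hG]
      linarith
    rw [this, abs_neg]
    exact norm_integral_le_of_norm_le (f := q) hgint.integrableOn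
      (Filter.Eventually.of_forall hbd)
  set f : ℝ → ℝ := fun x => Real.exp (x ^ 2 / 2) * G x with hf
  have hee : ∀ x : ℝ, Real.exp (x ^ 2 / 2) * Real.exp (-x ^ 2 / 2) = 1 := by
    intro x
    rw [← Real.exp_add, show x ^ 2 / 2 + -x ^ 2 / 2 = 0 by ring, Real.exp_zero]
  have hxf : ∀ x, |x * f x| ≤ 1 := by
    intro x
    have e : |x * f x| = Real.exp (x ^ 2 / 2) * (|x| * |G x|) := by
      rw [hf, abs_mul, abs_mul, abs_of_pos (Real.exp_pos _)]; ring
    rw [e, ← hee x]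
    refine mul_le_mul_of_nonneg_left ?_ (Real.exp_pos _).le
    rcases le_total 0 x with hx | hx
    · rw [abs_of_nonneg hx]
      exact (mul_le_mul_of_nonneg_left (hGle2 x) hx).trans mul_integral_Ioi_exp_le
    · rw [abs_of_nonpos hx]
      exact (mul_le_mul_of_nonneg_left (hGle1 x) (by linarith)).trans neg_mul_integral_Iic_exp_le
  refine ⟨f, fun x => x * f x + h x - c, ?_, fun x => rfl, ?_, hxf⟩
  · intro x
    have d1 : HasDerivAt (fun x : ℝ => Real.exp (x ^ 2 / 2)) (x * Real.exp (x ^ 2 / 2)) x := by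
      have : HasDerivAt (fun t : ℝ => t ^ 2 / 2) x x := by
        refine ((hasDerivAt_pow 2 x).div_const 2).congr_deriv ?_
        norm_num
      exact this.exp.congr_deriv (by ring)
    refine (d1.mul (hGderiv x)).congr_deriv ?_
    have := hee x
    simp only [hf, hq]
    linear_combination (h x - c) * this
  · intro x
    rcases le_or_gt |x| 1 with hx | hx
    · have e : |f x| = Real.exp (x ^ 2 / 2) * |G x| := by
        rw [hf, abs_mul, abs_of_pos (Real.exp_pos _)]
      have hx2 : x ^ 2 ≤ 1 := by
        have := sq_abs x
        nlinarith [abs_nonneg x]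
      have e1 : Real.exp (x ^ 2 / 2) ≤ 5 / 3 := by
        have s1 : Real.exp (x ^ 2 / 2) ^ 2 ≤ Real.exp 1 := by
          rw [← Real.exp_nat_mul]
          apply Real.exp_le_exp.2
          push_cast; linarith
        have := Real.exp_one_lt_d9
        have := Real.exp_pos (x ^ 2 / 2)
        nlinarith
      have e2 : |G x| ≤ 3 := by
        refine (hGle1 x).trans ((setIntegral_le_integral hgint
          (Filter.Eventually.of_forall fun t => (Real.exp_pos _).le)).trans ?_)
        rw [integral_exp_neg_sq_div_two]
        apply Real.sqrt_le_iff.2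
        have := Real.pi_lt_four
        constructor <;> linarith
      rw [e]
      have := abs_nonneg (G x)
      have := Real.exp_pos (x ^ 2 / 2)
      nlinarith
    · have := hxf x
      rw [abs_mul] at this
      have := abs_nonneg (f x)
      nlinarith

lemma stein_taylor {h f f' : ℝ → ℝ} {K c : ℝ} (h0 : ∀ x, 0 ≤ h x)
    (h1 : ∀ x, h x ≤ 1) (hc0 : 0 ≤ c) (hc1 : c ≤ 1)
    (hL : ∀ x y, |h x - h y| ≤ K * |x - y|)
    (hd : ∀ x, HasDerivAt f (f' x) x) (he : ∀ x, f' x = x * f x + h x - c)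
    (hf : ∀ x, |f x| ≤ 5) (hxf : ∀ x, |x * f x| ≤ 1) :
    (∀ x y, |f x - f y| ≤ 2 * |x - y|) ∧
    ∀ w t, 0 ≤ t → |f (w + t) - f w - t * f' w| ≤ t ^ 2 * (2 * |w| + 5 + K) := by
  have hf' : ∀ x, |f' x| ≤ 2 := by
    intro x
    rw [he, add_sub_assoc]
    refine (abs_add_le _ _).trans ?_
    have : |h x - c| ≤ 1 := by
      rw [abs_le]; constructor <;> linarith [h0 x, h1 x]
    linarith [hxf x]
  have hlip : ∀ x y, |f x - f y| ≤ 2 * |x - y| := by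
    intro x y
    have := convex_univ.norm_image_sub_le_of_norm_hasDerivWithin_le (f := f) (f' := f') (C := 2)
      (fun x _ => (hd x).hasDerivWithinAt) (fun x _ => hf' x) (Set.mem_univ y) (Set.mem_univ x)
    simpa [Real.norm_eq_abs] using this
  refine ⟨hlip, fun w t ht => ?_⟩
  have hder : ∀ s ∈ Set.Icc 0 t, ‖f' (w + s) - f' w‖ ≤ t * (2 * |w| + 5 + K) := by
    intro s hs
    have hs0 : 0 ≤ s := hs.1
    have e : f' (w + s) - f' w = w * (f (w + s) - f w) + s * f (w + s) + (h (w + s) - h w) := by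
      rw [he, he]; ring
    have a1 := hlip (w + s) w
    have a2 := hL (w + s) w
    rw [add_sub_cancel_left, abs_of_nonneg hs0] at a1 a2
    have a3 : |s * f (w + s)| ≤ s * 5 := by
      rw [abs_mul, abs_of_nonneg hs0]
      exact mul_le_mul_of_nonneg_left (hf _) hs0
    have a4 : |w * (f (w + s) - f w)| ≤ |w| * (2 * s) := by
      rw [abs_mul]
      exact mul_le_mul_of_nonneg_left a1 (abs_nonneg _)
    have hK : 0 ≤ K := by
      have := (abs_nonneg _).trans (hL 1 0)
      simpa using this
    rw [Real.norm_eq_abs, e]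
    calc |w * (f (w + s) - f w) + s * f (w + s) + (h (w + s) - h w)|
        ≤ |w * (f (w + s) - f w)| + |s * f (w + s)| + |h (w + s) - h w| := abs_add_three _ _ _
      _ ≤ s * (2 * |w| + 5 + K) := by linarith
      _ ≤ t * (2 * |w| + 5 + K) := by
        have : 0 ≤ 2 * |w| + 5 + K := by positivity
        exact mul_le_mul_of_nonneg_right hs.2 this
  have hd2 : ∀ s ∈ Set.Icc 0 t, HasDerivWithinAt (fun s => f (w + s) - s * f' w)
      (f' (w + s) - f' w) (Set.Icc 0 t) s := by
    intro s _
    have d1 : HasDerivAt (fun s => f (w + s)) (f' (w + s)) s := by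
      have := (hd (w + s)).comp_const_add w s
      exact this
    have d2 : HasDerivAt (fun s => s * f' w) (f' w) s := by
      simpa using (hasDerivAt_id s).mul_const (f' w)
    exact (d1.sub d2).hasDerivWithinAt
  have := (convex_Icc (0 : ℝ) t).norm_image_sub_le_of_norm_hasDerivWithin_le hd2 hder
    (Set.left_mem_Icc.2 ht) (Set.right_mem_Icc.2 ht)
  simp only [Real.norm_eq_abs, add_zero, zero_mul, sub_zero, abs_of_nonneg ht] at this
  calc |f (w + t) - f w - t * f' w| = |f (w + t) - t * f' w - f w| := by congr 1; ring
    _ ≤ _ := this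
    _ = _ := by ring

lemma stdNormalCDF_mono : Monotone stdNormalCDF := by
  intro x y hxy
  unfold stdNormalCDF
  refine mul_le_mul_of_nonneg_left ?_ (by positivity)
  exact setIntegral_mono_set integrable_exp_neg_sq_div_two.integrableOn
    (Filter.Eventually.of_forall fun t => (Real.exp_pos _).le)
    (Set.Iic_subset_Iic.2 hxy).eventuallyLE

lemma stdNormalCDF_sub_le {x y : ℝ} (hxy : x ≤ y) :
    stdNormalCDF y - stdNormalCDF x ≤ y - x := by
  unfold stdNormalCDF
  rw [← mul_sub, intervalIntegral.integral_Iic_sub_Iic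
    integrable_exp_neg_sq_div_two.integrableOn integrable_exp_neg_sq_div_two.integrableOn]
  have h1 : ∫ t in x..y, Real.exp (-t ^ 2 / 2) ≤ ∫ _ in x..y, (1 : ℝ) := by
    refine intervalIntegral.integral_mono_on hxy
      integrable_exp_neg_sq_div_two.intervalIntegrable (by simp) fun t _ => ?_
    rw [Real.exp_le_one_iff]
    have := sq_nonneg t
    linarith
  rw [intervalIntegral.integral_const, smul_eq_mul, mul_one] at h1
  have h2 : (Real.sqrt (2 * Real.pi))⁻¹ ≤ 1 := by
    apply inv_le_one_of_one_le₀
    apply Real.one_le_sqrt.2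
    have := Real.pi_gt_three
    linarith
  have h3 : 0 ≤ (Real.sqrt (2 * Real.pi))⁻¹ := by positivity
  nlinarith

lemma abs_stdNormalCDF_sub_le (x y : ℝ) : |stdNormalCDF x - stdNormalCDF y| ≤ |x - y| := by
  rcases le_total x y with h | h
  · rw [abs_sub_comm, abs_sub_comm x, abs_of_nonneg (sub_nonneg.2 (stdNormalCDF_mono h)),
      abs_of_nonneg (sub_nonneg.2 h)]
    exact stdNormalCDF_sub_le h
  · rw [abs_of_nonneg (sub_nonneg.2 (stdNormalCDF_mono h)), abs_of_nonneg (sub_nonneg.2 h)]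
    exact stdNormalCDF_sub_le h

lemma stdNormalCDF_nonneg (x : ℝ) : 0 ≤ stdNormalCDF x := by
  unfold stdNormalCDF
  have : 0 ≤ ∫ t in Set.Iic x, Real.exp (-t ^ 2 / 2) :=
    integral_nonneg fun t => (Real.exp_pos _).le
  positivity

lemma stdNormalCDF_le_one (x : ℝ) : stdNormalCDF x ≤ 1 := by
  unfold stdNormalCDF
  have h : ∫ t in Set.Iic x, Real.exp (-t ^ 2 / 2) ≤ ∫ t : ℝ, Real.exp (-t ^ 2 / 2) :=
    setIntegral_le_integral integrable_exp_neg_sq_div_two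
      (Filter.Eventually.of_forall fun t => (Real.exp_pos _).le)
  rw [integral_exp_neg_sq_div_two] at h
  have hsq : 0 < Real.sqrt (2 * Real.pi) := Real.sqrt_pos.2 (by positivity)
  rw [inv_mul_le_iff₀ hsq, mul_one]
  exact h

/-- The piecewise linear function equal to `1` left of `z` and to `0` right of `z + δ`. -/
def ramp (z δ x : ℝ) : ℝ := max 0 (min 1 ((z + δ - x) / δ))

lemma ramp_nonneg (z δ x : ℝ) : 0 ≤ ramp z δ x := le_max_left _ _

lemma ramp_le_one (z δ x : ℝ) : ramp z δ x ≤ 1 := max_le zero_le_one (min_le_left _ _)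

lemma abs_ramp_sub_le {δ : ℝ} (hδ : 0 < δ) (z x y : ℝ) :
    |ramp z δ x - ramp z δ y| ≤ 1 / δ * |x - y| := by
  have e : 1 / δ * |x - y| = |(z + δ - x) / δ - (z + δ - y) / δ| := by
    rw [← sub_div, abs_div, abs_of_pos hδ, sub_sub_sub_cancel_left, abs_sub_comm]
    ring
  rw [e]
  refine (abs_max_sub_max_le_max _ _ _ _).trans (max_le (by simp) ?_)
  exact (abs_min_sub_min_le_max _ _ _ _).trans (max_le (by simp) le_rfl)

lemma le_ramp {δ : ℝ} (hδ : 0 < δ) (z x : ℝ) : (if x ≤ z then (1 : ℝ) else 0) ≤ ramp z δ x := by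
  split_ifs with h
  · refine le_max_of_le_right (le_min le_rfl ?_)
    rw [le_div_iff₀ hδ]; linarith
  · exact ramp_nonneg _ _ _

lemma ramp_le {δ : ℝ} (hδ : 0 < δ) (z x : ℝ) :
    ramp z δ x ≤ if x ≤ z + δ then (1 : ℝ) else 0 := by
  split_ifs with h
  · exact ramp_le_one _ _ _
  · refine max_le le_rfl ((min_le_right _ _).trans ?_)
    exact div_nonpos_of_nonpos_of_nonneg (by linarith) hδ.le

lemma stdNormalCDF_eq_integral_ite (z : ℝ) : stdNormalCDF z =
    (Real.sqrt (2 * Real.pi))⁻¹ * ∫ t, (if t ≤ z then (1 : ℝ) else 0) * Real.exp (-t ^ 2 / 2) := by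
  unfold stdNormalCDF
  rw [← integral_indicator measurableSet_Iic]
  congr 2
  funext t
  simp [Set.indicator_apply]

lemma integrable_bounded_mul_exp {h : ℝ → ℝ} (hm : Measurable h) (h0 : ∀ x, 0 ≤ h x)
    (h1 : ∀ x, h x ≤ 1) : Integrable (fun t => h t * Real.exp (-t ^ 2 / 2)) := by
  refine integrable_exp_neg_sq_div_two.mono' (by fun_prop) (Filter.Eventually.of_forall fun t => ?_)
  rw [Real.norm_eq_abs, abs_mul, abs_of_nonneg (h0 t), abs_of_pos (Real.exp_pos _)]
  have := h1 t
  have := Real.exp_pos (-t ^ 2 / 2)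
  nlinarith

lemma measurable_ite_le (z : ℝ) : Measurable fun t : ℝ => if t ≤ z then (1 : ℝ) else 0 :=
  Measurable.ite measurableSet_Iic measurable_const measurable_const

lemma measurable_ramp (z δ : ℝ) : Measurable (ramp z δ) := by
  unfold ramp; fun_prop

lemma gauss_ramp_bounds {δ : ℝ} (hδ : 0 < δ) (z : ℝ) :
    stdNormalCDF z ≤ (Real.sqrt (2 * Real.pi))⁻¹ * ∫ t, ramp z δ t * Real.exp (-t ^ 2 / 2) ∧
    (Real.sqrt (2 * Real.pi))⁻¹ * ∫ t, ramp z δ t * Real.exp (-t ^ 2 / 2) ≤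
      stdNormalCDF (z + δ) := by
  have hi : ∀ z : ℝ, Integrable
      (fun t => (if t ≤ z then (1 : ℝ) else 0) * Real.exp (-t ^ 2 / 2)) := fun z =>
    integrable_bounded_mul_exp (measurable_ite_le z) (fun x => by split_ifs <;> norm_num)
      (fun x => by split_ifs <;> norm_num)
  have hr := integrable_bounded_mul_exp (measurable_ramp z δ) (ramp_nonneg z δ) (ramp_le_one z δ)
  rw [stdNormalCDF_eq_integral_ite, stdNormalCDF_eq_integral_ite]
  refine ⟨mul_le_mul_of_nonneg_left (integral_mono (hi z) hr fun t => ?_) (by positivity),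
    mul_le_mul_of_nonneg_left (integral_mono hr (hi _) fun t => ?_) (by positivity)⟩
  · exact mul_le_mul_of_nonneg_right (le_ramp hδ z t) (Real.exp_pos _).le
  · exact mul_le_mul_of_nonneg_right (ramp_le hδ z t) (Real.exp_pos _).le

lemma permE_abs_standardized_le {m : ℕ} {τ : ℝ} (hτ : 0 < τ) (hτ2 : τ ^ 2 = logSum 2 m) :
    permE m (fun s => |(s - logSum 1 m) / τ|) ≤ 1 := by
  have h1 : permE m (fun s => |(s - logSum 1 m) / τ|) ≤
      permE m (fun s => 1 / (2 * τ ^ 2) * (s - logSum 1 m) ^ 2 + 1 / 2) := by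
    refine permE_mono fun s => ?_
    have e : 1 / (2 * τ ^ 2) * (s - logSum 1 m) ^ 2 = |(s - logSum 1 m) / τ| ^ 2 / 2 := by
      rw [sq_abs]; field_simp
    rw [e]
    nlinarith [sq_nonneg (|(s - logSum 1 m) / τ| - 1)]
  refine h1.trans ?_
  rw [permE_add, permE_const_mul, permE_const]
  have h2 := permE_var_le m
  rw [← hτ2] at h2
  have h3 : 1 / (2 * τ ^ 2) * permE m (fun s => (s - logSum 1 m) ^ 2) ≤
      1 / (2 * τ ^ 2) * τ ^ 2 := by gcongr
  have h4 : 1 / (2 * τ ^ 2) * τ ^ 2 = 1 / 2 := by field_simp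
  linarith

/-- Stein's identity for `log` of the product of cycle lengths, up to an explicit error. -/
lemma abs_permE_stein_le {m : ℕ} {τ M : ℝ} (hτ : 0 < τ) (hτ2 : τ ^ 2 = logSum 2 m)
    {f f' : ℝ → ℝ} (hM : 0 ≤ M) (hlip : ∀ x y, |f x - f y| ≤ 2 * |x - y|)
    (htaylor : ∀ w t, 0 ≤ t → |f (w + t) - f w - t * f' w| ≤ t ^ 2 * (2 * |w| + M)) :
    |permE m (fun s => (s - logSum 1 m) / τ * f ((s - logSum 1 m) / τ)) -
        permE m (fun s => f' ((s - logSum 1 m) / τ))| ≤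
      4 * Real.log m ^ 2 / τ ^ 2 + Real.log m / τ * (2 + M) := by
  set μ := logSum 1 m with hμ
  set g : ℝ → ℝ := fun s => f ((s - μ) / τ) with hg
  have hglip : ∀ c x y, |g (x + c) - g (y + c)| ≤ 2 / τ * |x - y| := by
    intro c x y
    refine (hlip _ _).trans (le_of_eq ?_)
    rw [← sub_div, abs_div, abs_of_pos hτ,
      show x + c - μ - (y + c - μ) = x - y by ring]
    ring
  have hΛ : 0 ≤ Real.log (m : ℝ) := Real.log_natCast_nonneg m
  have hlog : ∀ j : ℕ, 0 ≤ Real.log (j : ℝ) := fun j => Real.log_natCast_nonneg j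
  have hloglow : ∀ j ∈ Finset.Icc 1 m, Real.log (j : ℝ) ≤ Real.log m := by
    intro j hj
    rw [Finset.mem_Icc] at hj
    exact Real.log_le_log (by exact_mod_cast hj.1) (by exact_mod_cast hj.2)
  set D1 : ℝ := ∑ j ∈ Finset.Icc 1 m, Real.log j / j *
    (permE (m - j) (fun s => g (s + Real.log j)) - permE m (fun s => g (s + Real.log j)))
    with hD1
  set D2 : ℝ := ∑ j ∈ Finset.Icc 1 m, Real.log j / j *
    permE m (fun s => g (s + Real.log j) - g s - Real.log j / τ * f' ((s - μ) / τ)) with hD2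
  have hsplit : permE m (fun s => (s - μ) / τ * f ((s - μ) / τ)) -
      permE m (fun s => f' ((s - μ) / τ)) = 1 / τ * D1 + 1 / τ * D2 := by
    have e1 : permE m (fun s => (s - μ) / τ * f ((s - μ) / τ)) =
        1 / τ * (permE m (fun s => s * g s) - μ * permE m g) := by
      rw [← permE_const_mul m μ, ← permE_sub, ← permE_const_mul]
      congr 1; funext s; simp only [hg]; ring
    have e2 : ∀ j ∈ Finset.Icc 1 m, Real.log j / j *
        permE m (fun s => g (s + Real.log j) - g s - Real.log j / τ * f' ((s - μ) / τ)) =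
        Real.log j / j * permE m (fun s => g (s + Real.log j)) -
        Real.log j ^ 1 / j * permE m g - Real.log j ^ 2 / j *
          (1 / τ * permE m (fun s => f' ((s - μ) / τ))) := by
      intro j _
      rw [permE_sub, permE_sub, permE_const_mul]
      ring
    have e3 : D2 = ∑ j ∈ Finset.Icc 1 m,
        Real.log j / j * permE m (fun s => g (s + Real.log j)) -
        μ * permE m g - τ ^ 2 * (1 / τ * permE m (fun s => f' ((s - μ) / τ))) := by
      rw [hD2, Finset.sum_congr rfl e2, Finset.sum_sub_distrib, Finset.sum_sub_distrib,
        ← Finset.sum_mul, ← Finset.sum_mul, hτ2, hμ]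
      rfl
    have e4 : D1 = permE m (fun s => s * g s) - ∑ j ∈ Finset.Icc 1 m,
        Real.log j / j * permE m (fun s => g (s + Real.log j)) := by
      rw [hD1, permE_mul_self]
      simp_rw [mul_sub]
      rw [Finset.sum_sub_distrib]
    rw [e1, e3, e4]
    field_simp
    ring
  have hD1le : |D1| ≤ 4 * Real.log m ^ 2 / τ := by
    have : ∀ j ∈ Finset.Icc 1 m, |Real.log j / j *
        (permE (m - j) (fun s => g (s + Real.log j)) -
          permE m (fun s => g (s + Real.log j)))| ≤
        2 * Real.log m ^ 2 / τ * (1 / (j : ℝ) * ∑ i ∈ Finset.Ioc (m - j) m, 1 / (i : ℝ)) := by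
      intro j hj
      have h1 := abs_permE_sub_le (Nat.sub_le m j) (hglip (Real.log j))
      rw [abs_mul, abs_sub_comm, abs_of_nonneg (div_nonneg (hlog j) (Nat.cast_nonneg j))]
      have h2 : Real.log (j : ℝ) / j ≤ Real.log m / j :=
        div_le_div_of_nonneg_right (hloglow j hj) (Nat.cast_nonneg j)
      calc _ ≤ Real.log m / j * (2 / τ * (Real.log m * ∑ i ∈ Finset.Ioc (m - j) m, 1 / (i : ℝ))) :=
            mul_le_mul h2 h1 (abs_nonneg _) (by positivity)
        _ = _ := by ring
    refine (Finset.abs_sum_le_sum_abs _ _).trans ((Finset.sum_le_sum this).trans ?_)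
    rw [← Finset.mul_sum]
    calc _ ≤ 2 * Real.log m ^ 2 / τ * 2 :=
          mul_le_mul_of_nonneg_left (sum_inv_mul_sum_Ioc_inv_le m) (by positivity)
      _ = _ := by ring
  have hD2le : |D2| ≤ Real.log m * (2 + M) := by
    have : ∀ j ∈ Finset.Icc 1 m, |Real.log j / j *
        permE m (fun s => g (s + Real.log j) - g s - Real.log j / τ * f' ((s - μ) / τ))| ≤
        Real.log j ^ 3 / j * ((2 + M) / τ ^ 2) := by
      intro j hj
      rw [abs_mul, abs_of_nonneg (div_nonneg (hlog j) (Nat.cast_nonneg j))]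
      have h1 : |permE m (fun s => g (s + Real.log j) - g s -
          Real.log j / τ * f' ((s - μ) / τ))| ≤ (Real.log j / τ) ^ 2 * (2 * 1 + M) := by
        refine (abs_permE_le _ _).trans ?_
        have h2 : permE m (fun s => |g (s + Real.log j) - g s -
            Real.log j / τ * f' ((s - μ) / τ)|) ≤
            permE m (fun s => (Real.log j / τ) ^ 2 * (2 * |(s - μ) / τ| + M)) := by
          refine permE_mono fun s => ?_
          have h3 := htaylor ((s - μ) / τ) (Real.log j / τ) (div_nonneg (hlog j) hτ.le)
          rw [show (s - μ) / τ + Real.log j / τ = (s + Real.log j - μ) / τ by ring] at h3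
          exact h3
        refine h2.trans ?_
        rw [permE_const_mul, permE_add, permE_const_mul, permE_const]
        have := permE_abs_standardized_le hτ hτ2
        gcongr
      calc _ ≤ Real.log j / j * ((Real.log j / τ) ^ 2 * (2 * 1 + M)) :=
            mul_le_mul_of_nonneg_left h1 (div_nonneg (hlog j) (Nat.cast_nonneg j))
        _ = _ := by ring
    refine (Finset.abs_sum_le_sum_abs _ _).trans ((Finset.sum_le_sum this).trans ?_)
    rw [← Finset.sum_mul]
    have h3 := logSum_three_le m
    rw [← hτ2] at h3
    calc logSum 3 m * ((2 + M) / τ ^ 2) ≤ Real.log m * τ ^ 2 * ((2 + M) / τ ^ 2) := by gcongr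
      _ = _ := by field_simp
  rw [hsplit, ← mul_add, abs_mul, abs_of_pos (by positivity : 0 < 1 / τ)]
  calc 1 / τ * |D1 + D2| ≤ 1 / τ * (4 * Real.log m ^ 2 / τ + Real.log m * (2 + M)) := by
        gcongr
        exact (abs_add_le _ _).trans (add_le_add hD1le hD2le)
    _ = _ := by field_simp

lemma abs_permE_ramp_sub_le {m : ℕ} {τ δ : ℝ} (hτ : 0 < τ) (hτ2 : τ ^ 2 = logSum 2 m)
    (hδ : 0 < δ) (z : ℝ) :
    |permE m (fun s => ramp z δ ((s - logSum 1 m) / τ)) -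
        (Real.sqrt (2 * Real.pi))⁻¹ * ∫ t, ramp z δ t * Real.exp (-t ^ 2 / 2)| ≤
      4 * Real.log m ^ 2 / τ ^ 2 + Real.log m / τ * (7 + 1 / δ) := by
  set c := (Real.sqrt (2 * Real.pi))⁻¹ * ∫ t, ramp z δ t * Real.exp (-t ^ 2 / 2) with hc
  have hK : 0 ≤ 1 / δ := by positivity
  obtain ⟨f, f', hd, he, hf, hxf⟩ := exists_stein_solution hK (ramp_nonneg z δ) (ramp_le_one z δ)
    (abs_ramp_sub_le hδ z) hc
  have hc01 := gauss_ramp_bounds hδ z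
  obtain ⟨hlip, ht⟩ := stein_taylor (ramp_nonneg z δ) (ramp_le_one z δ)
    ((stdNormalCDF_nonneg z).trans hc01.1) (hc01.2.trans (stdNormalCDF_le_one _))
    (abs_ramp_sub_le hδ z) hd he hf hxf
  have h := abs_permE_stein_le hτ hτ2 (M := 5 + 1 / δ) (by positivity) hlip
    (fun w t h0 => by rw [← add_assoc]; exact ht w t h0)
  have e : permE m (fun s => f' ((s - logSum 1 m) / τ)) =
      permE m (fun s => (s - logSum 1 m) / τ * f ((s - logSum 1 m) / τ)) +
      permE m (fun s => ramp z δ ((s - logSum 1 m) / τ)) - c := by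
    rw [← permE_add, ← permE_const m c, ← permE_sub]
    congr 1; funext s; rw [he]
  rw [e, abs_sub_comm] at h
  calc _ = _ := by congr 1; ring
    _ ≤ _ := h
    _ = _ := by ring

/-- Berry-Esseen type bound for `log` of the product of cycle lengths of a random permutation. -/
lemma abs_permE_indicator_sub_le {m : ℕ} {y : ℝ} (hy : 0 < y) (hy4 : y ^ 4 = Real.log m)
    (hm : 6 ≤ Real.log (m : ℝ)) (t : ℝ) :
    |permE m (fun s => if s ≤ t then 1 else 0) -
        stdNormalCDF ((t - logSum 1 m) / Real.sqrt (logSum 2 m))| ≤ 50 / y := by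
  set τ := Real.sqrt (logSum 2 m) with hτdef
  set μ := logSum 1 m
  have hτ2 : τ ^ 2 = logSum 2 m := Real.sq_sqrt (logSum_nonneg 2 m)
  have hy1 : 1 ≤ y := by
    by_contra hlt
    have : y ^ 4 ≤ 1 := pow_le_one₀ hy.le (by linarith)
    linarith
  have hlow : y ^ 12 / 6 ≤ τ ^ 2 := by
    have h1 := le_logSum_two m
    rw [hτ2]
    refine le_trans ?_ h1
    rw [← hy4] at hm ⊢
    nlinarith [pow_pos hy 8]
  have hτ : 0 < τ := by
    refine lt_of_le_of_ne (Real.sqrt_nonneg _) fun h => ?_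
    rw [← h] at hlow
    nlinarith [pow_pos hy 12]
  have hτy : y ^ 6 / 3 ≤ τ := by
    refine abs_le_of_sq_le_sq' ?_ hτ.le |>.2
    nlinarith [pow_pos hy 12]
  have hδ : 0 < 1 / y := by positivity
  have herr : 4 * Real.log m ^ 2 / τ ^ 2 + Real.log m / τ * (7 + 1 / (1 / y)) ≤ 49 / y - 1 / y := by
    rw [← hy4]
    have h1 : 4 * (y ^ 4) ^ 2 / τ ^ 2 ≤ 24 / y := by
      rw [div_le_div_iff₀ (by positivity) hy]
      have : y ^ 9 ≤ y ^ 12 := pow_le_pow_right₀ hy1 (by norm_num)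
      nlinarith
    have h2 : y ^ 4 / τ ≤ 3 / y ^ 2 := by
      rw [div_le_div_iff₀ hτ (by positivity)]
      nlinarith
    have h3 : y ^ 4 / τ * (7 + 1 / (1 / y)) ≤ 3 / y ^ 2 * (8 * y) := by
      have : 7 + 1 / (1 / y) ≤ 8 * y := by rw [one_div_one_div]; linarith
      have h7 : 0 ≤ 7 + 1 / (1 / y) := by positivity
      gcongr
    have h4 : 3 / y ^ 2 * (8 * y) = 24 / y := by field_simp; norm_num
    have h5 : 49 / y - 1 / y = 24 / y + 24 / y := by ring
    linarith
  set z := (t - μ) / τ with hz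
  have hind : ∀ s : ℝ, (if s ≤ t then (1 : ℝ) else 0) = if (s - μ) / τ ≤ z then (1 : ℝ) else 0 := by
    intro s
    refine if_congr ?_ rfl rfl
    rw [hz, div_le_div_iff_of_pos_right hτ, sub_le_sub_iff_right]
  simp_rw [hind]
  have hup := abs_permE_ramp_sub_le (m := m) hτ hτ2 hδ z
  have hdn := abs_permE_ramp_sub_le (m := m) hτ hτ2 hδ (z - 1 / y)
  have gup := gauss_ramp_bounds hδ z
  have gdn := gauss_ramp_bounds hδ (z - 1 / y)
  have mup : permE m (fun s => if (s - μ) / τ ≤ z then (1 : ℝ) else 0) ≤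
      permE m (fun s => ramp z (1 / y) ((s - μ) / τ)) :=
    permE_mono fun s => le_ramp hδ z _
  have mdn : permE m (fun s => ramp (z - 1 / y) (1 / y) ((s - μ) / τ)) ≤
      permE m (fun s => if (s - μ) / τ ≤ z then (1 : ℝ) else 0) := by
    refine permE_mono fun s => ?_
    have := ramp_le hδ (z - 1 / y) ((s - μ) / τ)
    rwa [sub_add_cancel] at this
  have c1 := stdNormalCDF_sub_le (x := z) (y := z + 1 / y) (by linarith)
  have c2 := stdNormalCDF_sub_le (x := z - 1 / y) (y := z) (by linarith)
  have hup' := (abs_le.1 (hup.trans herr)).2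
  have hdn' := (abs_le.1 (hdn.trans herr)).1
  have e : 50 / y = 49 / y + 1 / y := by ring
  rw [abs_le]
  constructor <;> linarith [gup.2, gdn.1]

lemma zkProb_mono {n k : ℕ} {p q : (Fin n → Fin n) → Prop} (h : ∀ f, p f → q f) :
    zkProb n k p ≤ zkProb n k q := by
  unfold zkProb
  gcongr
  exact h _

lemma zkProb_add_not {n k r : ℕ} (hk : 0 < k) (hn : n = k * r) (p : (Fin n → Fin n) → Prop) :
    zkProb n k p + zkProb n k (fun f => ¬ p f) = 1 := by
  have hN : ((zkMaps n k).card : ℝ) ≠ 0 := by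
    have := zkMaps_card_pos hk hn
    positivity
  rw [zkProb, zkProb, ← add_div, ← Nat.cast_add, Finset.card_filter_add_card_filter_not,
    div_self hN]

lemma Zmap_le {n : ℕ} (f : Fin n → Fin n) : Zmap f ≤ n := by
  unfold Zmap
  simpa using Finset.card_le_univ (cyclicSet f)

lemma sum_zkProb_Zmap {n k : ℕ} (p : ℕ → Prop) :
    ∑ m ∈ (Finset.range (n + 1)).filter p, zkProb n k (fun f => Zmap f = m) =
      zkProb n k (fun f => p (Zmap f)) := by
  simp only [zkProb_eq]
  rw [← Finset.sum_div, ← Nat.cast_sum]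
  congr 2
  rw [Finset.card_eq_sum_card_fiberwise (f := Zmap) (t := (Finset.range (n + 1)).filter p)]
  · refine Finset.sum_congr rfl fun m hm => ?_
    rw [Finset.filter_filter]
    congr 1
    refine Finset.filter_congr fun f _ => ?_
    rw [Finset.mem_filter] at hm
    constructor
    · rintro h; exact ⟨h ▸ hm.2, h⟩
    · exact fun h => h.2
  · intro f hf
    simp only [Finset.coe_filter, Set.mem_ofPred_eq, Finset.mem_range] at hf ⊢
    exact ⟨Nat.lt_succ_of_le (Zmap_le f), hf.2⟩

lemma sum_range_cast (j : ℕ) : ∑ i ∈ Finset.range j, (i : ℝ) = (j : ℝ) * (j - 1) / 2 := by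
  induction j with
  | zero => simp
  | succ j ih => rw [Finset.sum_range_succ, ih]; push_cast; ring

lemma zkProb_le_Zmap_le_exp {n k r j : ℕ} (hk : 0 < k) (hr : 0 < r) (hn : n = k * r)
    (hj : 2 ≤ j) :
    zkProb n k (fun f => j ≤ Zmap f) ≤
      Real.exp (-(((k : ℝ) - 1) / n * ((j : ℝ) * (j - 1) / 2))) := by
  rcases lt_or_ge n j with hnj | hjn
  · have : zkProb n k (fun f => j ≤ Zmap f) = 0 := by
      rw [zkProb_eq, Finset.filter_false_of_mem]
      · simp
      · intro f _
        have := Zmap_le f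
        omega
    rw [this]
    exact (Real.exp_pos _).le
  rw [zkProb_le_Zmap hk hn hj hjn]
  rcases lt_or_ge r j with hrj | hjr
  · have : ∏ i ∈ Finset.range j, ((n : ℝ) - i * k) / ((n : ℝ) - i) = 0 := by
      refine Finset.prod_eq_zero (Finset.mem_range.2 hrj) ?_
      rw [hn]; push_cast
      rw [mul_comm, sub_self, zero_div]
    rw [this]
    exact (Real.exp_pos _).le
  · rw [← sum_range_cast, Finset.mul_sum, ← Finset.sum_neg_distrib, Real.exp_sum]
    have hk1 : (1 : ℝ) ≤ k := by exact_mod_cast hk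
    have hn0 : (0 : ℝ) < n := by
      have : 0 < n := by rw [hn]; positivity
      positivity
    have hmem : ∀ i ∈ Finset.range j, (i : ℝ) * k < n := by
      intro i hi
      rw [Finset.mem_range] at hi
      have : i * k < n := by
        rw [hn, mul_comm k]
        exact Nat.mul_lt_mul_of_pos_right (by omega) hk
      exact_mod_cast this
    refine Finset.prod_le_prod (fun i hi => ?_) fun i hi => ?_
    · have h1 := hmem i hi
      have h2 : (i : ℝ) ≤ i * k := le_mul_of_one_le_right (Nat.cast_nonneg i) hk1
      exact div_nonneg (by linarith) (by linarith)
    · have h1 := hmem i hi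
      have h2 : (i : ℝ) ≤ i * k := le_mul_of_one_le_right (Nat.cast_nonneg i) hk1
      have hi0 : (0 : ℝ) ≤ i := Nat.cast_nonneg i
      have h3 := Real.add_one_le_exp (-(((k : ℝ) - 1) / n * i))
      refine le_trans ?_ h3
      rw [div_le_iff₀ (by linarith)]
      have e : (-(((k : ℝ) - 1) / n * i) + 1) * (n - i) - (n - i * k) =
          ((k : ℝ) - 1) * i ^ 2 / n := by
        field_simp; ring
      have : 0 ≤ ((k : ℝ) - 1) * i ^ 2 / n := by
        have : 0 ≤ (k : ℝ) - 1 := by linarith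
        positivity
      linarith

lemma one_sub_sum_le_prod_one_sub {j : ℕ} {x : ℕ → ℝ} (h0 : ∀ i < j, 0 ≤ x i)
    (h1 : ∀ i < j, x i ≤ 1) :
    1 - ∑ i ∈ Finset.range j, x i ≤ ∏ i ∈ Finset.range j, (1 - x i) := by
  induction j with
  | zero => simp
  | succ j ih =>
    have ih := ih (fun i hi => h0 i (by omega)) (fun i hi => h1 i (by omega))
    rw [Finset.sum_range_succ, Finset.prod_range_succ]
    have hs : 0 ≤ ∑ i ∈ Finset.range j, x i :=
      Finset.sum_nonneg fun i hi => h0 i (by rw [Finset.mem_range] at hi; omega)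
    have a0 := h0 j (by omega)
    have a1 := h1 j (by omega)
    nlinarith

lemma zkProb_Zmap_lt_le {n k r j : ℕ} (hk : 2 ≤ k) (hn : n = k * r) (hj : 2 ≤ j) (hjr : j ≤ r) :
    zkProb n k (fun f => Zmap f < j) ≤ ((k : ℝ) - 1) / n * (j : ℝ) ^ 2 := by
  have hk0 : 0 < k := by omega
  have hjn : j ≤ n := by rw [hn]; nlinarith
  have hk2 : (2 : ℝ) ≤ k := by exact_mod_cast hk
  have hn0 : (0 : ℝ) < n := by
    have : 0 < n := by omega
    positivity
  have h1 := zkProb_add_not hk0 hn (fun f => j ≤ Zmap f)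
  rw [zkProb_le_Zmap hk0 hn hj hjn] at h1
  simp only [not_le] at h1
  have hik : ∀ i < j, (i : ℝ) * k ≤ n := by
    intro i hi
    have : i * k ≤ n := by
      rw [hn, mul_comm k]
      exact Nat.mul_le_mul_right k (by omega)
    exact_mod_cast this
  have hi2 : ∀ i < j, (n : ℝ) / 2 ≤ n - i := by
    intro i hi
    have a := hik i hi
    have b : (i : ℝ) * 2 ≤ i * k := by gcongr
    linarith
  have h2 := one_sub_sum_le_prod_one_sub (j := j) (x := fun i => i * ((k : ℝ) - 1) / (n - i))
    (fun i hi => by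
      have := hi2 i hi
      have : 0 ≤ (k : ℝ) - 1 := by linarith
      exact div_nonneg (by positivity) (by linarith))
    (fun i hi => by
      have := hi2 i hi
      have := hik i hi
      rw [div_le_one (by linarith)]
      linarith)
  have h3 : ∏ i ∈ Finset.range j, (1 - i * ((k : ℝ) - 1) / (n - i)) =
      ∏ i ∈ Finset.range j, ((n : ℝ) - i * k) / ((n : ℝ) - i) := by
    refine Finset.prod_congr rfl fun i hi => ?_
    have := hi2 i (Finset.mem_range.1 hi)
    have hne : (n : ℝ) - i ≠ 0 := by linarith
    field_simp
    ring
  have h4 : ∑ i ∈ Finset.range j, i * ((k : ℝ) - 1) / (n - i) ≤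
      ∑ i ∈ Finset.range j, 2 * ((k : ℝ) - 1) / n * i := by
    refine Finset.sum_le_sum fun i hi => ?_
    have := hi2 i (Finset.mem_range.1 hi)
    have hk1 : 0 ≤ (k : ℝ) - 1 := by linarith
    calc i * ((k : ℝ) - 1) / (n - i) ≤ i * ((k : ℝ) - 1) / (n / 2) := by gcongr
      _ = _ := by ring
  rw [← Finset.mul_sum, sum_range_cast] at h4
  have h5 : 2 * ((k : ℝ) - 1) / n * ((j : ℝ) * (j - 1) / 2) ≤ ((k : ℝ) - 1) / n * (j : ℝ) ^ 2 := by
    have e : ((k : ℝ) - 1) / n * (j : ℝ) ^ 2 - 2 * ((k : ℝ) - 1) / n * ((j : ℝ) * (j - 1) / 2) =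
      ((k : ℝ) - 1) / n * j := by ring
    have hk1 : 0 ≤ (k : ℝ) - 1 := by linarith
    have : 0 ≤ ((k : ℝ) - 1) / n * j := by positivity
    linarith
  linarith

lemma permE_indicator_mem_Icc (m : ℕ) (t : ℝ) :
    permE m (fun s => if s ≤ t then 1 else 0) ∈ Set.Icc (0 : ℝ) 1 := by
  constructor
  · refine (permE_const m 0).ge.trans (permE_mono fun s => ?_)
    split_ifs <;> norm_num
  · refine le_trans (permE_mono (h := fun _ => 1) fun s => ?_) (permE_const m 1).le
    split_ifs <;> norm_num

/-- A mixture over the number of cyclic nodes inherits a uniform bound on likely values. -/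
lemma abs_zkProb_log_Bmap_sub_le {n k r : ℕ} (hk : 0 < k) (hn : n = k * r) {t Φ ε η : ℝ}
    (hΦ0 : 0 ≤ Φ) (hΦ1 : Φ ≤ 1) (hη : 0 ≤ η) (good : ℕ → Prop)
    (hgood : ∀ m, good m → |permE m (fun s => if s ≤ t then 1 else 0) - Φ| ≤ η)
    (hbad : zkProb n k (fun f => ¬ good (Zmap f)) ≤ ε) :
    |zkProb n k (fun f => Real.log (Bmap f : ℝ) ≤ t) - Φ| ≤ ε + η := by
  have hp0 : ∀ m, 0 ≤ zkProb n k (fun f => Zmap f = m) := fun m => by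
    unfold zkProb; positivity
  have htot : ∑ m ∈ Finset.range (n + 1), zkProb n k (fun f => Zmap f = m) = 1 := by
    have h1 := sum_zkProb_Zmap (n := n) (k := k) (fun _ => True)
    have h2 := zkProb_add_not hk hn (fun _ => True)
    have h3 : zkProb n k (fun _ => ¬ True) = 0 := by
      simp [zkProb]
    rw [Finset.filter_true] at h1
    linarith
  rw [zkProb_log_Bmap]
  have e : ∑ m ∈ Finset.range (n + 1), zkProb n k (fun f => Zmap f = m) *
      permE m (fun s => if s ≤ t then 1 else 0) - Φ =
      ∑ m ∈ Finset.range (n + 1), zkProb n k (fun f => Zmap f = m) *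
      (permE m (fun s => if s ≤ t then 1 else 0) - Φ) := by
    simp_rw [mul_sub]
    rw [Finset.sum_sub_distrib, ← Finset.sum_mul, htot, one_mul]
  rw [e]
  refine (Finset.abs_sum_le_sum_abs _ _).trans ?_
  have h1 : ∀ m ∈ Finset.range (n + 1), |zkProb n k (fun f => Zmap f = m) *
      (permE m (fun s => if s ≤ t then 1 else 0) - Φ)| ≤
      (if ¬ good m then zkProb n k (fun f => Zmap f = m) else 0) +
        zkProb n k (fun f => Zmap f = m) * η := by
    intro m _
    rw [abs_mul, abs_of_nonneg (hp0 m)]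
    have hi := permE_indicator_mem_Icc m t
    by_cases hg : good m
    · have := mul_le_mul_of_nonneg_left (hgood m hg) (hp0 m)
      rwa [if_neg (not_not.2 hg), zero_add]
    · rw [if_pos hg]
      have : |permE m (fun s => if s ≤ t then 1 else 0) - Φ| ≤ 1 := by
        rw [abs_le]; constructor <;> linarith [hi.1, hi.2]
      have := mul_le_mul_of_nonneg_left this (hp0 m)
      have := mul_nonneg (hp0 m) hη
      linarith
  refine (Finset.sum_le_sum h1).trans ?_
  have h2 := sum_zkProb_Zmap (n := n) (k := k) (fun m => ¬ good m)
  rw [Finset.sum_filter] at h2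
  rw [Finset.sum_add_distrib, ← Finset.sum_mul, htot, one_mul]
  refine add_le_add (le_trans (le_of_eq ?_) hbad) le_rfl
  rw [← h2]
  congr!

/-- The number of cyclic nodes is close to `√(n/λ)` on a logarithmic scale. -/
lemma zkProb_log_Zmap_far_le {n k r : ℕ} {L w : ℝ} (hk : 2 ≤ k) (hr : 0 < r) (hn : n = k * r)
    (hL : L = Real.log (Real.sqrt ((n : ℝ) / ((k : ℝ) - 1)))) (hw : 3 ≤ w) (hwL : w + 1 ≤ L) :
    zkProb n k (fun f => ¬ (Real.exp (L - w) ≤ Zmap f ∧ (Zmap f : ℝ) ≤ Real.exp (L + w))) ≤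
      4 / w := by
  have hk0 : 0 < k := by omega
  have hk2 : (2 : ℝ) ≤ k := by exact_mod_cast hk
  have hk1 : 0 < (k : ℝ) - 1 := by linarith
  have hr0 : (0 : ℝ) < r := by exact_mod_cast hr
  have hnr : (n : ℝ) = k * r := by rw [hn]; push_cast; ring
  have hn0 : (0 : ℝ) < n := by rw [hnr]; positivity
  have hw0 : 0 < w := by linarith
  have hsq : Real.exp L ^ 2 = (n : ℝ) / ((k : ℝ) - 1) := by
    rw [hL, Real.exp_log (Real.sqrt_pos.2 (by positivity)), Real.sq_sqrt (by positivity)]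
  have hinv : ((k : ℝ) - 1) / n * Real.exp L ^ 2 = 1 := by
    rw [hsq]; field_simp
  set q := ((k : ℝ) - 1) / n with hq
  have hq0 : 0 < q := by positivity
  have hEw : 2 * w ≤ Real.exp w ^ 2 := by
    rw [← Real.exp_nat_mul]
    have := Real.add_one_le_exp (((2 : ℕ) : ℝ) * w)
    push_cast at this ⊢
    linarith
  have hE0 := Real.exp_pos L
  have hEw0 := Real.exp_pos w
  -- upper tail
  have hup : zkProb n k (fun f => ¬ (Zmap f : ℝ) ≤ Real.exp (L + w)) ≤ 2 / w := by
    set j := ⌈Real.exp (L + w)⌉₊ with hj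
    have hjge : Real.exp L * Real.exp w ≤ j := by rw [← Real.exp_add]; exact Nat.le_ceil _
    have hj2 : (2 : ℝ) ≤ j := by
      have := Real.add_one_le_exp (L + w)
      rw [Real.exp_add] at this
      linarith
    have h1 : zkProb n k (fun f => ¬ (Zmap f : ℝ) ≤ Real.exp (L + w)) ≤
        zkProb n k (fun f => j ≤ Zmap f) := by
      refine zkProb_mono fun f hf => ?_
      exact Nat.ceil_le.2 (not_le.1 hf).le
    refine h1.trans ((zkProb_le_Zmap_le_exp hk0 hr hn (by exact_mod_cast hj2)).trans ?_)
    have h2 : (Real.exp L * Real.exp w) ^ 2 / 4 ≤ (j : ℝ) * (j - 1) / 2 := by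
      have : (Real.exp L * Real.exp w) ^ 2 ≤ (j : ℝ) ^ 2 := by gcongr
      nlinarith
    have h3 : Real.exp w ^ 2 / 4 ≤ q * ((j : ℝ) * (j - 1) / 2) := by
      have := mul_le_mul_of_nonneg_left h2 hq0.le
      have e : q * ((Real.exp L * Real.exp w) ^ 2 / 4) =
        (q * Real.exp L ^ 2) * Real.exp w ^ 2 / 4 := by ring
      rw [e, hinv, one_mul] at this
      exact this
    have h4 : w / 2 ≤ q * ((j : ℝ) * (j - 1) / 2) := by linarith
    have h5 := Real.add_one_le_exp (q * ((j : ℝ) * (j - 1) / 2))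
    rw [Real.exp_neg, inv_le_comm₀ (Real.exp_pos _) (by positivity), inv_div]
    linarith
  -- lower tail
  have hlow : zkProb n k (fun f => ¬ Real.exp (L - w) ≤ Zmap f) ≤ 2 / w := by
    set j := ⌈Real.exp (L - w)⌉₊ with hj
    have hpos1 : 2 ≤ Real.exp (L - w) := by
      have := Real.add_one_le_exp (L - w)
      linarith
    have hj2 : (2 : ℝ) ≤ j := hpos1.trans (Nat.le_ceil _)
    have hjle : (j : ℝ) ≤ 2 * Real.exp (L - w) := by
      have := Nat.ceil_lt_add_one (Real.exp_pos (L - w)).le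
      linarith
    have hE4 : 4 ≤ Real.exp L := by
      have := Real.add_one_le_exp L
      linarith
    have hjr : (j : ℝ) ≤ r := by
      have a1 : Real.exp (L - w) ≤ Real.exp L := Real.exp_le_exp.2 (by linarith)
      have a2 : Real.exp L ^ 2 ≤ 2 * r := by
        rw [hsq, div_le_iff₀ hk1, hnr]
        nlinarith
      nlinarith
    have h1 : zkProb n k (fun f => ¬ Real.exp (L - w) ≤ Zmap f) ≤
        zkProb n k (fun f => Zmap f < j) := by
      refine zkProb_mono fun f hf => ?_
      exact Nat.lt_ceil.2 (not_le.1 hf)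
    refine h1.trans ((zkProb_Zmap_lt_le hk hn (by exact_mod_cast hj2)
      (by exact_mod_cast hjr)).trans ?_)
    have h2 : (j : ℝ) ^ 2 ≤ (2 * (Real.exp L / Real.exp w)) ^ 2 := by
      rw [← Real.exp_sub]; gcongr
    have h3 := mul_le_mul_of_nonneg_left h2 hq0.le
    have e : q * (2 * (Real.exp L / Real.exp w)) ^ 2 =
      (q * Real.exp L ^ 2) * 4 / Real.exp w ^ 2 := by field_simp; ring
    rw [e, hinv] at h3
    refine h3.trans ?_
    rw [div_le_div_iff₀ (by positivity) hw0]
    linarith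
  have hunion : zkProb n k
      (fun f => ¬ (Real.exp (L - w) ≤ Zmap f ∧ (Zmap f : ℝ) ≤ Real.exp (L + w))) ≤
      zkProb n k (fun f => ¬ Real.exp (L - w) ≤ Zmap f) +
        zkProb n k (fun f => ¬ (Zmap f : ℝ) ≤ Real.exp (L + w)) := by
    simp only [zkProb_eq]
    rw [← add_div]
    gcongr
    rw [← Nat.cast_add, Nat.cast_le]
    refine le_trans (Finset.card_le_card ?_) (Finset.card_union_le _ _)
    intro f hf
    simp only [Finset.mem_union, Finset.mem_filter] at hf ⊢
    tauto
  have e : 4 / w = 2 / w + 2 / w := by ring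
  linarith

lemma abs_standardized_sub_le {m : ℕ} {w x : ℝ} (hw : 3 ≤ w)
    (hm : |Real.log m - w ^ 4| ≤ w) :
    |(1 / 2 * (w ^ 4) ^ 2 + x * ((Real.sqrt 3)⁻¹ * w ^ 6) - logSum 1 m) /
        Real.sqrt (logSum 2 m) - x| ≤ 28 / w + 240 * |x| / w ^ 3 := by
  set τ := Real.sqrt (logSum 2 m)
  set l := Real.log (m : ℝ)
  set σ := (Real.sqrt 3)⁻¹ * w ^ 6 with hσ
  have hw0 : 0 < w := by linarith
  obtain ⟨hm1, hm2⟩ := abs_le.1 hm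
  have hw3 : 27 ≤ w ^ 3 := by
    calc (27 : ℝ) = 3 ^ 3 := by norm_num
      _ ≤ w ^ 3 := by gcongr
  have hw4 : 27 * w ≤ w ^ 4 := by
    have : w ^ 4 = w ^ 3 * w := by ring
    rw [this]; gcongr
  have hl1 : w ^ 4 / 2 ≤ l := by linarith
  have hl2 : l ≤ 3 / 2 * w ^ 4 := by linarith
  have hl6 : 6 ≤ l := by nlinarith
  have hτ2 : τ ^ 2 = logSum 2 m := Real.sq_sqrt (logSum_nonneg 2 m)
  have hσ2 : σ ^ 2 = w ^ 12 / 3 := by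
    rw [hσ, mul_pow, inv_pow, Real.sq_sqrt (by norm_num)]; ring
  have hσ0 : 0 < σ := by positivity
  have t1 := le_logSum_two m
  have t2 := logSum_two_le m
  have u1 := le_logSum_one m
  have u2 := logSum_one_le m
  have hτlow : w ^ 12 / 48 ≤ τ ^ 2 := by
    rw [hτ2]
    have h1 : l ^ 3 / 6 ≤ l ^ 3 / 3 - l ^ 2 := by nlinarith [sq_nonneg l]
    have h2 : (w ^ 4 / 2) ^ 3 ≤ l ^ 3 := by gcongr
    have h3 : (w ^ 4 / 2) ^ 3 = w ^ 12 / 8 := by ring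
    linarith
  have hτ : 0 < τ := by
    refine lt_of_le_of_ne (Real.sqrt_nonneg _) fun h => ?_
    rw [← h] at hτlow
    nlinarith [pow_pos hw0 12]
  have hτw : w ^ 6 / 7 ≤ τ := by
    refine (abs_le_of_sq_le_sq' ?_ hτ.le).2
    nlinarith [pow_pos hw0 12]
  have hmean : |1 / 2 * (w ^ 4) ^ 2 - logSum 1 m| ≤ 4 * w ^ 5 := by
    have h1 : |l ^ 2 - (w ^ 4) ^ 2| ≤ w * (5 / 2 * w ^ 4) := by
      rw [sq_sub_sq, abs_mul, mul_comm]
      have : |l + w ^ 4| ≤ 5 / 2 * w ^ 4 := by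
        rw [abs_of_nonneg (by positivity)]; linarith
      gcongr
    have h2 : l ≤ 3 / 2 * w ^ 5 := by
      have : w ^ 4 ≤ w ^ 5 := pow_le_pow_right₀ (by linarith) (by norm_num)
      linarith
    have h3 : w * (5 / 2 * w ^ 4) = 5 / 2 * w ^ 5 := by ring
    rw [h3] at h1
    obtain ⟨h4, h5⟩ := abs_le.1 h1
    rw [abs_le]
    have := pow_pos hw0 5
    constructor <;> linarith
  have hvar : |σ ^ 2 - τ ^ 2| ≤ 5 * w ^ 9 := by
    have h1 : |l ^ 3 - (w ^ 4) ^ 3| ≤ w * (19 / 4 * w ^ 8) := by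
      have e : l ^ 3 - (w ^ 4) ^ 3 = (l - w ^ 4) * (l ^ 2 + l * w ^ 4 + (w ^ 4) ^ 2) := by ring
      rw [e, abs_mul]
      have : |l ^ 2 + l * w ^ 4 + (w ^ 4) ^ 2| ≤ 19 / 4 * w ^ 8 := by
        rw [abs_of_nonneg (by positivity)]
        have a1 : l ^ 2 ≤ (3 / 2 * w ^ 4) ^ 2 := by gcongr
        have a2 : l * w ^ 4 ≤ 3 / 2 * w ^ 4 * w ^ 4 := by gcongr
        nlinarith
      gcongr
    have h2 : l ^ 2 ≤ 9 / 12 * w ^ 9 := by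
      have a1 : l ^ 2 ≤ (3 / 2 * w ^ 4) ^ 2 := by gcongr
      have a2 : 3 * w ^ 8 ≤ w ^ 9 := by
        have : w ^ 9 = w * w ^ 8 := by ring
        rw [this]; gcongr
      have a3 : (3 / 2 * w ^ 4) ^ 2 = 9 / 4 * w ^ 8 := by ring
      linarith
    have h3 : w * (19 / 4 * w ^ 8) = 19 / 4 * w ^ 9 := by ring
    rw [h3] at h1
    obtain ⟨h4, h5⟩ := abs_le.1 h1
    have h6 : (w ^ 4) ^ 3 = w ^ 12 := by ring
    rw [h6] at h4 h5
    rw [hσ2, hτ2, abs_le]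
    have := pow_pos hw0 9
    constructor <;> linarith
  have hsd : |σ - τ| / τ ≤ 240 / w ^ 3 := by
    have h1 : |σ - τ| * τ ≤ |σ ^ 2 - τ ^ 2| := by
      rw [sq_sub_sq, abs_mul, mul_comm, abs_of_pos (by positivity : 0 < σ + τ)]
      gcongr
      linarith
    rw [div_le_div_iff₀ hτ (by positivity)]
    have h2 : |σ - τ| * w ^ 3 * τ ≤ 240 * τ * τ := by
      have h3 : |σ - τ| * τ * w ^ 3 ≤ 5 * w ^ 9 * w ^ 3 := by
        have := h1.trans hvar
        gcongr
      have h4 : 5 * w ^ 9 * w ^ 3 = 5 * w ^ 12 := by ring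
      nlinarith
    exact le_of_mul_le_mul_right h2 hτ
  have e : (1 / 2 * (w ^ 4) ^ 2 + x * σ - logSum 1 m) / τ - x =
      (1 / 2 * (w ^ 4) ^ 2 - logSum 1 m) / τ + x * ((σ - τ) / τ) := by
    field_simp; ring
  rw [e]
  refine (abs_add_le _ _).trans (add_le_add ?_ ?_)
  · rw [abs_div, abs_of_pos hτ, div_le_div_iff₀ hτ hw0]
    calc |1 / 2 * (w ^ 4) ^ 2 - logSum 1 m| * w ≤ 4 * w ^ 5 * w := by gcongr
      _ = 28 * (w ^ 6 / 7) := by ring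
      _ ≤ 28 * τ := by gcongr
  · rw [abs_mul, abs_div, abs_of_pos hτ]
    calc |x| * (|σ - τ| / τ) ≤ |x| * (240 / w ^ 3) := by gcongr
      _ = _ := by ring

/-- Quantitative normal approximation for `log B` in terms of `w = log^{1/4} √(n/λ)`. -/
lemma abs_zkProb_sub_stdNormalCDF_le {n k r : ℕ} {w : ℝ} (hk : 2 ≤ k) (hr : 0 < r)
    (hn : n = k * r) (hw : 3 ≤ w)
    (hL : w ^ 4 = Real.log (Real.sqrt ((n : ℝ) / ((k : ℝ) - 1)))) (x : ℝ) :
    |zkProb n k (fun f => Real.log (Bmap f : ℝ) ≤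
        1 / 2 * (w ^ 4) ^ 2 + x * ((Real.sqrt 3)⁻¹ * w ^ 6)) - stdNormalCDF x| ≤
      132 / w + 240 * |x| / w ^ 3 := by
  have hw0 : 0 < w := by linarith
  have hw4 : 27 * w ≤ w ^ 4 := by
    have h3 : (3 : ℝ) ^ 3 ≤ w ^ 3 := by gcongr
    have : w ^ 4 = w ^ 3 * w := by ring
    rw [this]; gcongr; linarith
  have hη : 0 ≤ 128 / w + 240 * |x| / w ^ 3 := by positivity
  have hfar := zkProb_log_Zmap_far_le hk hr hn hL hw (by linarith)
  have e : 132 / w + 240 * |x| / w ^ 3 = 4 / w + (128 / w + 240 * |x| / w ^ 3) := by ring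
  rw [e]
  refine abs_zkProb_log_Bmap_sub_le (by omega) hn (stdNormalCDF_nonneg x) (stdNormalCDF_le_one x)
    hη (fun m => Real.exp (w ^ 4 - w) ≤ m ∧ (m : ℝ) ≤ Real.exp (w ^ 4 + w)) ?_ hfar
  intro m hm
  have hm0 : (0 : ℝ) < m := (Real.exp_pos _).trans_le hm.1
  have h1 : w ^ 4 - w ≤ Real.log m := (Real.le_log_iff_exp_le hm0).2 hm.1
  have h2 : Real.log m ≤ w ^ 4 + w := (Real.log_le_iff_le_exp hm0).2 hm.2
  have hl0 : 0 < Real.log (m : ℝ) := by linarith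
  set y := Real.sqrt (Real.sqrt (Real.log (m : ℝ))) with hy
  have hy0 : 0 < y := Real.sqrt_pos.2 (Real.sqrt_pos.2 hl0)
  have hy4 : y ^ 4 = Real.log m := by
    rw [show y ^ 4 = (y ^ 2) ^ 2 by ring, hy, Real.sq_sqrt (Real.sqrt_nonneg _),
      Real.sq_sqrt hl0.le]
  have hyw : w / 2 ≤ y := by
    refine le_of_pow_le_pow_left₀ (n := 4) (by norm_num) hy0.le ?_
    rw [hy4, div_pow]
    linarith
  have h3 := abs_permE_indicator_sub_le hy0 hy4 (by linarith)
    (1 / 2 * (w ^ 4) ^ 2 + x * ((Real.sqrt 3)⁻¹ * w ^ 6))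
  have h4 := abs_standardized_sub_le (x := x) hw (m := m)
    (abs_le.2 ⟨by linarith, by linarith⟩)
  have h5 := (abs_stdNormalCDF_sub_le _ _).trans h4
  have h6 : 50 / y ≤ 100 / w := by
    rw [div_le_div_iff₀ hy0 hw0]; linarith
  have h7 : 128 / w = 100 / w + 28 / w := by ring
  refine (abs_sub_le _ _ _).trans ((add_le_add h3 h5).trans ?_)
  rw [h7]
  linarith

/-- `log B` is asymptotically normal over `{0,k}`-mappings, with an
explicit error bound. -/
theorem stmt_14 (k n : ℕ → ℕ) (α : ℝ) (hα1 : 0 < α) (hα2 : α < 1)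
    (hk : ∀ r, 2 ≤ k r) (hn : ∀ r, n r = k r * r)
    (hko : (fun r : ℕ => (k r : ℝ)) =o[atTop] (fun r : ℕ => (n r : ℝ) ^ (1 - α)))
    (lam μ σn : ℕ → ℝ)
    (hlam : ∀ r, lam r = (k r : ℝ) - 1)
    (hμ : ∀ r, μ r = 1 / 2 * (Real.log (Real.sqrt ((n r : ℝ) / lam r))) ^ 2)
    (hσ : ∀ r, σn r =
      (Real.sqrt 3)⁻¹ * (Real.log (Real.sqrt ((n r : ℝ) / lam r))) ^ ((3 : ℝ) / 2)) :
    (∀ x : ℝ,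
      Tendsto (fun r => zkProb (n r) (k r)
          (fun f => Real.log ((Bmap f : ℝ)) ≤ μ r + x * σn r))
        atTop (nhds (stdNormalCDF x))) ∧
    ∃ C₁ C₂ : ℝ, 0 < C₁ ∧ 0 < C₂ ∧
      ∀ᶠ r : ℕ in atTop, ∀ x : ℝ,
        |zkProb (n r) (k r) (fun f => Real.log ((Bmap f : ℝ)) ≤ μ r + x * σn r) -
            stdNormalCDF x| ≤
          C₁ * |x| / (Real.log (Real.sqrt ((n r : ℝ) / lam r))) ^ ((3 : ℝ) / 4) +
          C₂ * (Real.log (Real.log (n r : ℝ))) ^ 2 /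
            (Real.log ((n r : ℝ) / lam r)) ^ ((1 : ℝ) / 4) := by
  set L : ℕ → ℝ := fun r => Real.log (Real.sqrt ((n r : ℝ) / lam r)) with hL
  have hk2 : ∀ r, (2 : ℝ) ≤ k r := fun r => by exact_mod_cast hk r
  have hlam0 : ∀ r, 0 < lam r := fun r => by rw [hlam]; linarith [hk2 r]
  have hn2 : ∀ r, (n r : ℝ) = k r * r := fun r => by rw [hn]; push_cast; ring
  have hratio : ∀ r : ℕ, (r : ℝ) ≤ n r / lam r := fun r => by
    rw [le_div_iff₀ (hlam0 r), hn2, hlam]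
    nlinarith [Nat.cast_nonneg (α := ℝ) r]
  have hN : Tendsto (fun r => (n r : ℝ) / lam r) atTop atTop :=
    tendsto_atTop_mono hratio tendsto_natCast_atTop_atTop
  have hLtop : Tendsto L atTop atTop :=
    Real.tendsto_log_atTop.comp (Real.tendsto_sqrt_atTop.comp hN)
  set w : ℕ → ℝ := fun r => L r ^ ((1 : ℝ) / 4) with hwdef
  have hw : Tendsto w atTop atTop := (tendsto_rpow_atTop (by norm_num)).comp hLtop
  have hpow : ∀ (r : ℕ) (j : ℕ), 0 ≤ L r → w r ^ j = L r ^ ((j : ℝ) / 4) := fun r j h => by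
    rw [hwdef, ← Real.rpow_natCast, ← Real.rpow_mul h]
    congr 1
    ring
  have hmain : ∀ᶠ r : ℕ in atTop, ∀ x : ℝ,
      |zkProb (n r) (k r) (fun f => Real.log ((Bmap f : ℝ)) ≤ μ r + x * σn r) -
        stdNormalCDF x| ≤ 132 / w r + 240 * |x| / w r ^ 3 := by
    filter_upwards [hw.eventually_ge_atTop 3, eventually_gt_atTop 0,
      hLtop.eventually_ge_atTop 0] with r hr3 hr0 hL0 x
    have h4 : w r ^ 4 = L r := by rw [hpow r 4 hL0]; norm_num
    have h6 : w r ^ 6 = L r ^ ((3 : ℝ) / 2) := by rw [hpow r 6 hL0]; norm_num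
    rw [hμ, hσ]
    have h := abs_zkProb_sub_stdNormalCDF_le (hk r) hr0 (hn r) hr3
      (h4.trans (by simp only [hL, hlam])) x
    rwa [h4, h6] at h
  refine ⟨fun x => ?_, 240, 264, by norm_num, by norm_num, ?_⟩
  · rw [tendsto_iff_dist_tendsto_zero]
    have hw3 : Tendsto (fun r => w r ^ 3) atTop atTop :=
      (tendsto_pow_atTop (by norm_num)).comp hw
    have hlim : Tendsto (fun r => 132 / w r + 240 * |x| / w r ^ 3) atTop (nhds 0) := by
      simpa using (hw.const_div_atTop 132).add (hw3.const_div_atTop (240 * |x|))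
    refine squeeze_zero' (Eventually.of_forall fun r => dist_nonneg) ?_ hlim
    filter_upwards [hmain] with r hr
    exact hr x
  · have hntop : Tendsto (fun r => (n r : ℝ)) atTop atTop := by
      refine tendsto_atTop_mono (fun r => ?_) tendsto_natCast_atTop_atTop
      rw [hn2]
      nlinarith [hk2 r, Nat.cast_nonneg (α := ℝ) r]
    have hloglog := (Real.tendsto_log_atTop.comp Real.tendsto_log_atTop).comp hntop
    filter_upwards [hmain, hw.eventually_ge_atTop 3, hLtop.eventually_ge_atTop 0,
      hloglog.eventually_ge_atTop 1, hN.eventually_gt_atTop 1] with r hr hr3 hL0 hll hN1 x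
    have h3 : w r ^ 3 = L r ^ ((3 : ℝ) / 4) := by rw [hpow r 3 hL0]; norm_num
    have hlogN : Real.log ((n r : ℝ) / lam r) = 2 * L r := by
      simp only [hL]
      rw [Real.log_sqrt (by linarith)]
      ring
    have hq0 : 0 < Real.log ((n r : ℝ) / lam r) ^ ((1 : ℝ) / 4) :=
      Real.rpow_pos_of_pos (Real.log_pos hN1) _
    have hq : Real.log ((n r : ℝ) / lam r) ^ ((1 : ℝ) / 4) ≤ 2 * w r := by
      rw [hlogN, Real.mul_rpow (by norm_num) hL0]
      have : (2 : ℝ) ^ ((1 : ℝ) / 4) ≤ 2 ^ (1 : ℝ) :=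
        Real.rpow_le_rpow_of_exponent_le (by norm_num) (by norm_num)
      rw [Real.rpow_one] at this
      gcongr
    have hll2 : 1 ≤ Real.log (Real.log (n r : ℝ)) ^ 2 := one_le_pow₀ hll
    have h1 : 132 / w r ≤ 264 * Real.log (Real.log (n r : ℝ)) ^ 2 /
        Real.log ((n r : ℝ) / lam r) ^ ((1 : ℝ) / 4) := by
      rw [div_le_div_iff₀ (by linarith) hq0]
      nlinarith
    refine (hr x).trans ?_
    rw [h3, add_comm]
    exact add_le_add le_rfl h1
end
end

section
/- Fix integers r ≥ 1 and k ≥ 2 and set n = kr. For permutations σ, τ of [n], define the mapping f_{σ,τ} : [n] → [n] by f_{σ,τ}(τ(ik + j)) = σ(i + 1) for all 0 ≤ i ≤ r − 1 and 1 ≤ j ≤ k. Then f_{σ,τ} is a {0,k}-mapping on [n], and for every {0,k}-mapping f on [n] the number of pairs (σ, τ) ∈ S_n × S_n with f_{σ,τ} = f equals r!·(n − r)!·(k!)^r. Consequently, if σ and τ are independent uniform random permutations of [n], then f_{σ,τ} is a uniformly random {0,k}-mapping on [n]. -/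
open Filter Finset Asymptotics MeasureTheory

noncomputable section

open scoped Classical

/-- Permutations carrying `a` to `b`, when both have the same fibre sizes, are counted by the
product of the factorials of these sizes. -/
theorem card_perm_comp_eq {α ι : Type*} [Fintype α] [DecidableEq α] [Fintype ι] [DecidableEq ι]
    (a b : α → ι)
    (h : ∀ i, #{x | a x = i} = #{x | b x = i}) :
    #{τ : Equiv.Perm α | b ∘ τ = a} = ∏ i, (#{x | a x = i}).factorial := by
  have e : ∀ i, Nonempty ({x // a x = i} ≃ {x // b x = i}) := fun i =>
    Fintype.card_eq.mp (by simpa [Fintype.card_subtype] using h i)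
  let τ₀ : Equiv.Perm α := Equiv.ofFiberEquiv fun i => (e i).some
  have hτ₀ : ∀ x, b (τ₀ x) = a x := fun x => Equiv.ofFiberEquiv_map _ x
  have key := DomMulAct.stabilizer_card a
  simp only [Fintype.card_subtype] at key
  rw [← key]
  refine Finset.card_bij' (fun τ _ => τ₀⁻¹ * τ) (fun τ _ => τ₀ * τ) ?_ ?_ ?_ ?_
  · intro τ hτ
    simp only [mem_filter, mem_univ, true_and] at hτ ⊢
    funext x
    simpa using (hτ₀ (τ₀⁻¹ (τ x))).symm.trans (by simpa using congrFun hτ x)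
  · intro τ hτ
    simp only [mem_filter, mem_univ, true_and] at hτ ⊢
    funext x
    simpa [hτ₀] using congrFun hτ x
  · simp
  · simp

/-- The number of permutations mapping `s` onto a set `t` of the same size. -/
theorem card_perm_mem_iff {α : Type*} [Fintype α] [DecidableEq α] (s t : Finset α) (h : #s = #t) :
    #{σ : Equiv.Perm α | ∀ x, σ x ∈ t ↔ x ∈ s} =
      (#s).factorial * (Fintype.card α - #s).factorial := by
  have hfib : ∀ u : Finset α, ∀ i : Bool,
      #{x | decide (x ∈ u) = i} = if i then #u else Fintype.card α - #u := by
    intro u i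
    cases i
    · simp [← Finset.card_compl, Finset.filter_notMem_eq_sdiff, Finset.compl_eq_univ_sdiff]
    · simp
  have key := card_perm_comp_eq (fun x => decide (x ∈ s)) (fun x => decide (x ∈ t))
    (fun i => by rw [hfib, hfib, h])
  rw [Fintype.prod_bool, hfib, hfib] at key
  simpa [funext_iff] using key

theorem IsZKMap.card_fiber {n k : ℕ} {f : Fin n → Fin n} (hf : IsZKMap k f) (y : Fin n) :
    #{x | f x = y} = if y ∈ univ.image f then k else 0 := by
  split_ifs with hy
  · obtain ⟨x, -, rfl⟩ := Finset.mem_image.mp hy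
    refine (hf (f x)).resolve_left fun h => ?_
    simpa using (Finset.card_eq_zero.mp h).le (mem_filter.mpr ⟨mem_univ x, rfl⟩)
  · rw [Finset.card_eq_zero, Finset.filter_eq_empty_iff]
    rintro x - rfl
    exact hy (mem_image_of_mem f (mem_univ x))

theorem IsZKMap.mul_card_image {n k : ℕ} {f : Fin n → Fin n} (hf : IsZKMap k f) :
    k * #(univ.image f) = n := by
  have h := Finset.card_eq_sum_card_fiberwise (f := f) (s := univ) (t := univ) (by simp)
  simp only [hf.card_fiber, Finset.sum_ite_mem, Finset.univ_inter, Finset.sum_const,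
    Finset.card_univ, Fintype.card_fin, smul_eq_mul] at h
  rw [mul_comm, ← h]

/-- The number of pairs of permutations carrying one `{0,k}`-mapping to another. -/
theorem IsZKMap.card_perm_pairs {k r : ℕ} (hk : 0 < k) {f g : Fin (k * r) → Fin (k * r)}
    (hf : IsZKMap k f) (hg : IsZKMap k g) :
    #{p : Equiv.Perm (Fin (k * r)) × Equiv.Perm (Fin (k * r)) | f ∘ p.2 = p.1 ∘ g} =
      r.factorial * (k * r - r).factorial * k.factorial ^ r := by
  have hfr := Nat.eq_of_mul_eq_mul_left hk hf.mul_card_image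
  have hgr := Nat.eq_of_mul_eq_mul_left hk hg.mul_card_image
  have hτ : ∀ σ : Equiv.Perm (Fin (k * r)), #{τ : Equiv.Perm (Fin (k * r)) | f ∘ τ = σ ∘ g} =
      if ∀ x, σ x ∈ univ.image f ↔ x ∈ univ.image g then k.factorial ^ r else 0 := by
    intro σ
    split_ifs with hσ
    · have hfib : ∀ y, #{x | (σ ∘ g) x = y} = #{x | f x = y} := by
        intro y
        obtain ⟨z, rfl⟩ := σ.surjective y
        simp only [Function.comp_apply, EmbeddingLike.apply_eq_iff_eq]
        rw [hf.card_fiber, hg.card_fiber]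
        simp only [hσ z]
      rw [card_perm_comp_eq _ _ hfib]
      simp only [hfib, hf.card_fiber, apply_ite Nat.factorial, Nat.factorial_zero]
      rw [Finset.prod_ite_mem, Finset.univ_inter, Finset.prod_const, hfr]
    · rw [Finset.card_eq_zero, Finset.filter_eq_empty_iff]
      intro τ _ h
      refine hσ fun x => ?_
      simp only [mem_image, mem_univ, true_and]
      constructor
      · rintro ⟨y, hy⟩
        refine ⟨τ.symm y, σ.injective ?_⟩
        simpa [hy] using (congrFun h (τ.symm y)).symm
      · rintro ⟨y, rfl⟩
        exact ⟨τ y, congrFun h y⟩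
  calc _ = ∑ σ : Equiv.Perm (Fin (k * r)), #{τ : Equiv.Perm (Fin (k * r)) | f ∘ τ = σ ∘ g} := by
        simp only [Finset.card_filter, Fintype.sum_prod_type]
    _ = _ := by
        simp only [hτ]
        rw [← Finset.sum_filter, Finset.sum_const, smul_eq_mul]
        congr 1
        have h := card_perm_mem_iff _ _ (hgr.trans hfr.symm)
        rw [hgr, Fintype.card_fin] at h
        convert h

theorem isZKMap_div {k r : ℕ} (hk : 0 < k) :
    IsZKMap k fun p : Fin (k * r) =>
      (⟨(p : ℕ) / k, lt_of_le_of_lt (Nat.div_le_self _ _) p.isLt⟩ : Fin (k * r)) := by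
  intro y
  by_cases hy : (y : ℕ) < r
  · right
    have : (univ.filter fun p : Fin (k * r) => (p : ℕ) / k = y).map Fin.valEmbedding =
        Finset.Ico (k * y) (k * y + k) := by
      ext m
      have hm : m / k = y ↔ k * y ≤ m ∧ m < k * y + k := by
        rw [Nat.div_eq_iff hk, mul_comm k (y : ℕ)]
        omega
      have hyr : k * y + k ≤ k * r := by nlinarith
      simp only [Finset.mem_map, mem_filter, mem_univ, true_and, Fin.valEmbedding_apply, mem_Ico]
      constructor
      · rintro ⟨p, hp, rfl⟩
        exact hm.mp hp
      · intro h
        exact ⟨⟨m, h.2.trans_le hyr⟩, hm.mpr h, rfl⟩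
    simpa [Fin.ext_iff] using congrArg Finset.card this
  · left
    rw [Finset.card_eq_zero, Finset.filter_eq_empty_iff]
    rintro p - rfl
    exact hy (Nat.div_lt_of_lt_mul p.isLt)

theorem IsZKMap.comp_perm {n k : ℕ} {g : Fin n → Fin n} (hg : IsZKMap k g)
    (σ τ : Equiv.Perm (Fin n)) {f : Fin n → Fin n} (h : f ∘ τ = σ ∘ g) : IsZKMap k f := by
  intro y
  have : #{x | f x = y} = #{x | g x = σ.symm y} := by
    refine (Finset.card_equiv τ fun x => ?_).symm
    simp [show f (τ x) = σ (g x) from congrFun h x, Equiv.eq_symm_apply]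
  rw [this]
  exact hg _

/-- correctness of the sampling algorithm: `f_{σ,τ}` is always a
`{0,k}`-mapping, each `{0,k}`-mapping arises from exactly `r!(n−r)!(k!)^r` pairs
`(σ,τ)`, and hence `f_{σ,τ}` is uniform when `σ,τ` are uniform. -/
theorem stmt_15 (r k : ℕ) (hr : 1 ≤ r) (hk : 2 ≤ k)
    (F : Equiv.Perm (Fin (k * r)) → Equiv.Perm (Fin (k * r)) →
      (Fin (k * r) → Fin (k * r)))
    (hF : ∀ (σ τ : Equiv.Perm (Fin (k * r))) (p : Fin (k * r)),
      F σ τ (τ p) = σ ⟨(p : ℕ) / k, lt_of_le_of_lt (Nat.div_le_self _ _) p.isLt⟩) :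
    (∀ σ τ, IsZKMap k (F σ τ)) ∧
    (∀ f : Fin (k * r) → Fin (k * r), IsZKMap k f →
      (Finset.univ.filter
        (fun p : Equiv.Perm (Fin (k * r)) × Equiv.Perm (Fin (k * r)) =>
          F p.1 p.2 = f)).card =
        r.factorial * (k * r - r).factorial * k.factorial ^ r) ∧
    (∀ f : Fin (k * r) → Fin (k * r), IsZKMap k f →
      (zkMaps (k * r) k).card *
        (Finset.univ.filter
          (fun p : Equiv.Perm (Fin (k * r)) × Equiv.Perm (Fin (k * r)) =>
            F p.1 p.2 = f)).card =
        (k * r).factorial * (k * r).factorial) := by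
  have hk0 : 0 < k := by omega
  have hg := isZKMap_div (r := r) hk0
  have hcomp := fun σ τ => funext (hF σ τ)
  have hzk : ∀ σ τ, IsZKMap k (F σ τ) := fun σ τ => hg.comp_perm σ τ (hcomp σ τ)
  have hcount : ∀ f : Fin (k * r) → Fin (k * r), IsZKMap k f →
      #{p : Equiv.Perm (Fin (k * r)) × Equiv.Perm (Fin (k * r)) | F p.1 p.2 = f} =
        r.factorial * (k * r - r).factorial * k.factorial ^ r := by
    intro f hf
    rw [← hf.card_perm_pairs hk0 hg]
    congr 1
    ext ⟨σ, τ⟩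
    simp only [mem_filter, mem_univ, true_and]
    constructor
    · rintro rfl
      exact hcomp σ τ
    · intro h
      exact τ.surjective.injective_comp_right ((hcomp σ τ).trans h.symm)
  refine ⟨hzk, hcount, fun f hf => ?_⟩
  have htotal := Finset.card_eq_sum_card_fiberwise
    (f := fun p : Equiv.Perm (Fin (k * r)) × Equiv.Perm (Fin (k * r)) => F p.1 p.2)
    (s := univ) (t := zkMaps (k * r) k) (by intro p _; simp [zkMaps, hzk])
  rw [Finset.sum_const_nat fun f' hf' =>
    hcount f' (mem_filter.mp (show f' ∈ zkMaps (k * r) k from hf')).2, Finset.card_univ,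
    Fintype.card_prod, Fintype.card_perm, Fintype.card_fin] at htotal
  rw [hcount f hf, htotal]
end
end
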